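/- The Lusztig automorphisms satisfy the braid relations of the Weyl group: for i ≠ j in Î, if a_{ij} a_{ji} = 0 then T_i T_j = T_j T_i; if a_{ij} a_{ji} = 1 then T_i T_j T_i = T_j T_i T_j; if a_{ij} a_{ji} = 2 then T_i T_j T_i T_j = T_j T_i T_j T_i; and if a_{ij} a_{ji} = 3 then T_i T_j T_i T_j T_i T_j = T_j T_i T_j T_i T_j T_i. -/

import Mathlib

open scoped BigOperators TensorProduct

noncomputable section

/-- The base field `K = ℚ(q)` of rational functions over `ℚ`. -/
abbrev Kq : Type := RatFunc ℚ

/-- The element `q ∈ ℚ(q)`. -/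
def qvar : Kq := RatFunc.X

/-- Generators of the quantum affine algebra: `E_i`, `F_i`, `K_i`, `K_i⁻¹`, `γ^{1/2}`,
`γ^{-1/2}`. -/
inductive Gen (n : ℕ) : Type
  | E : Fin n → Gen n
  | F : Fin n → Gen n
  | K : Fin n → Gen n
  | Kinv : Fin n → Gen n
  | g : Gen n
  | ginv : Gen n

variable {n : ℕ}

/-- The free algebra on the generators. -/
abbrev FA (n : ℕ) : Type := FreeAlgebra Kq (Gen n)

/-- Inclusion of the generators into the free algebra. -/
def ι : Gen n → FA n := FreeAlgebra.ι Kq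

/-- `q_i = q^{d_i}`. -/
def qi (d : Fin n → ℕ) (i : Fin n) : Kq := qvar ^ (d i)

/-- The quantum integer `[m]_i = (q_i^m - q_i^{-m})/(q_i - q_i⁻¹)`. -/
def qint (d : Fin n → ℕ) (i : Fin n) (m : ℤ) : Kq :=
  (qi d i ^ m - qi d i ^ (-m)) / (qi d i - (qi d i)⁻¹)

/-- The quantum factorial `[m]_i!`. -/
def qfact (d : Fin n → ℕ) (i : Fin n) : ℕ → Kq
  | 0 => 1
  | m + 1 => qfact d i m * qint d i (m + 1)

/-- The quantum binomial coefficient `[m choose s]_i`. -/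
def qbinom (d : Fin n → ℕ) (i : Fin n) (m s : ℕ) : Kq :=
  qfact d i m / (qfact d i s * qfact d i (m - s))

/-- The quantum Serre element `∑_{s=0}^{1-a_{ij}} (-1)^s [1-a_{ij} choose s]_i
E_i^{1-a_{ij}-s} E_j E_i^s` in the free algebra. -/
def serreE (a : Fin n → Fin n → ℤ) (d : Fin n → ℕ) (i j : Fin n) : FA n :=
  ∑ s ∈ Finset.range ((1 - a i j).toNat + 1),
    ((-1 : Kq) ^ s * qbinom d i (1 - a i j).toNat s) •
      (ι (Gen.E i) ^ ((1 - a i j).toNat - s) * ι (Gen.E j) * ι (Gen.E i) ^ s)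

/-- The quantum Serre element in the `F`'s. -/
def serreF (a : Fin n → Fin n → ℤ) (d : Fin n → ℕ) (i j : Fin n) : FA n :=
  ∑ s ∈ Finset.range ((1 - a i j).toNat + 1),
    ((-1 : Kq) ^ s * qbinom d i (1 - a i j).toNat s) •
      (ι (Gen.F i) ^ ((1 - a i j).toNat - s) * ι (Gen.F j) * ι (Gen.F i) ^ s)

/-- The defining relations of the quantum affine algebra `U_q`. -/
inductive QRel (a : Fin n → Fin n → ℤ) (d r : Fin n → ℕ) : FA n → FA n → Prop
  | KKinv (i : Fin n) : QRel a d r (ι (Gen.K i) * ι (Gen.Kinv i)) 1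
  | KinvK (i : Fin n) : QRel a d r (ι (Gen.Kinv i) * ι (Gen.K i)) 1
  | gginv : QRel a d r (ι Gen.g * ι Gen.ginv) 1
  | ginvg : QRel a d r (ι Gen.ginv * ι Gen.g) 1
  | gcomm (x : Gen n) : QRel a d r (ι Gen.g * ι x) (ι x * ι Gen.g)
  | gsq : QRel a d r (ι Gen.g * ι Gen.g)
      (((List.finRange n).map fun i => ι (Gen.K i) ^ r i).prod)
  | KK (i j : Fin n) : QRel a d r (ι (Gen.K i) * ι (Gen.K j)) (ι (Gen.K j) * ι (Gen.K i))
  | KE (i j : Fin n) : QRel a d r (ι (Gen.K i) * ι (Gen.E j))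
      ((qi d i ^ (a i j)) • (ι (Gen.E j) * ι (Gen.K i)))
  | KF (i j : Fin n) : QRel a d r (ι (Gen.K i) * ι (Gen.F j))
      ((qi d i ^ (-(a i j))) • (ι (Gen.F j) * ι (Gen.K i)))
  | EF (i j : Fin n) : QRel a d r (ι (Gen.E i) * ι (Gen.F j) - ι (Gen.F j) * ι (Gen.E i))
      (if i = j then ((qi d i - (qi d i)⁻¹)⁻¹) • (ι (Gen.K i) - ι (Gen.Kinv i)) else 0)
  | serreEE (i j : Fin n) (h : i ≠ j) : QRel a d r (serreE a d i j) 0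
  | serreFF (i j : Fin n) (h : i ≠ j) : QRel a d r (serreF a d i j) 0

/-- The quantum affine algebra `U_q`, presented by the generators and relations above. -/
abbrev Uq (a : Fin n → Fin n → ℤ) (d r : Fin n → ℕ) : Type := RingQuot (QRel a d r)

/-- The images of the generators in `U_q`. -/
def gen (a : Fin n → Fin n → ℤ) (d r : Fin n → ℕ) (x : Gen n) : Uq a d r :=
  RingQuot.mkAlgHom Kq (QRel a d r) (ι x)

/-- The hypotheses on the Cartan data: `A = (a_{ij})` is a symmetrizable generalized Cartan
matrix with symmetrizing positive integers `d_i`, and the positive integers `r_i` satisfy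
`∑_i r_i d_i a_{ij} = 0` for all `j`. -/
structure CartanData (n : ℕ) (a : Fin n → Fin n → ℤ) (d r : Fin n → ℕ) : Prop where
  diag : ∀ i, a i i = 2
  offdiag : ∀ i j, i ≠ j → a i j ≤ 0
  zero_iff : ∀ i j, a i j = 0 ↔ a j i = 0
  symmetrizable : ∀ i j, (d i : ℤ) * a i j = (d j : ℤ) * a j i
  d_pos : ∀ i, 0 < d i
  r_pos : ∀ i, 0 < r i
  null : ∀ j, ∑ i, (r i : ℤ) * (d i : ℤ) * a i j = 0

/-- The divided power `E_i^{(s)} = E_i^s/[s]_i!`. -/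
def Ediv (a : Fin n → Fin n → ℤ) (d r : Fin n → ℕ) (i : Fin n) (s : ℕ) : Uq a d r :=
  (qfact d i s)⁻¹ • (gen a d r (Gen.E i)) ^ s

/-- The divided power `F_i^{(s)} = F_i^s/[s]_i!`. -/
def Fdiv (a : Fin n → Fin n → ℤ) (d r : Fin n → ℕ) (i : Fin n) (s : ℕ) : Uq a d r :=
  (qfact d i s)⁻¹ • (gen a d r (Gen.F i)) ^ s

/-- The power `K_i^m` for an integer `m` (using `K_i⁻¹` for negative `m`). -/
def Kzpow (a : Fin n → Fin n → ℤ) (d r : Fin n → ℕ) (i : Fin n) (m : ℤ) : Uq a d r :=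
  if 0 ≤ m then gen a d r (Gen.K i) ^ m.toNat else gen a d r (Gen.Kinv i) ^ (-m).toNat

/-- `T_i(E_j) = ∑_{s=0}^{-a_{ij}} (-1)^{s-a_{ij}} q_i^{-s} E_i^{(-a_{ij}-s)} E_j E_i^{(s)}`
(for `j ≠ i`); note `(-1)^{s-a_{ij}} = (-1)^{s+(-a_{ij})}` as `a_{ij} ≤ 0`. -/
def TE (a : Fin n → Fin n → ℤ) (d r : Fin n → ℕ) (i j : Fin n) : Uq a d r :=
  ∑ s ∈ Finset.range ((-(a i j)).toNat + 1),
    ((-1 : Kq) ^ (s + (-(a i j)).toNat) * ((qi d i)⁻¹) ^ s) •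
      (Ediv a d r i ((-(a i j)).toNat - s) * gen a d r (Gen.E j) * Ediv a d r i s)

/-- `T_i(F_j) = ∑_{s=0}^{-a_{ij}} (-1)^{s-a_{ij}} q_i^{s} F_i^{(s)} F_j F_i^{(-a_{ij}-s)}`
(for `j ≠ i`). -/
def TF (a : Fin n → Fin n → ℤ) (d r : Fin n → ℕ) (i j : Fin n) : Uq a d r :=
  ∑ s ∈ Finset.range ((-(a i j)).toNat + 1),
    ((-1 : Kq) ^ (s + (-(a i j)).toNat) * (qi d i) ^ s) •
      (Fdiv a d r i s * gen a d r (Gen.F j) * Fdiv a d r i ((-(a i j)).toNat - s))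

/-- `T_i⁻¹(E_j) = ∑_{s=0}^{-a_{ij}} (-1)^{s-a_{ij}} q_i^{-s} E_i^{(s)} E_j E_i^{(-a_{ij}-s)}`
(for `j ≠ i`). -/
def TEinv (a : Fin n → Fin n → ℤ) (d r : Fin n → ℕ) (i j : Fin n) : Uq a d r :=
  ∑ s ∈ Finset.range ((-(a i j)).toNat + 1),
    ((-1 : Kq) ^ (s + (-(a i j)).toNat) * ((qi d i)⁻¹) ^ s) •
      (Ediv a d r i s * gen a d r (Gen.E j) * Ediv a d r i ((-(a i j)).toNat - s))

/-- `T_i⁻¹(F_j) = ∑_{s=0}^{-a_{ij}} (-1)^{s-a_{ij}} q_i^{s} F_i^{(-a_{ij}-s)} F_j F_i^{(s)}`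
(for `j ≠ i`). -/
def TFinv (a : Fin n → Fin n → ℤ) (d r : Fin n → ℕ) (i j : Fin n) : Uq a d r :=
  ∑ s ∈ Finset.range ((-(a i j)).toNat + 1),
    ((-1 : Kq) ^ (s + (-(a i j)).toNat) * (qi d i) ^ s) •
      (Fdiv a d r i ((-(a i j)).toNat - s) * gen a d r (Gen.F j) * Fdiv a d r i s)

/-- The defining conditions on Lusztig's braid group operator `T_i`. -/
def TCond (a : Fin n → Fin n → ℤ) (d r : Fin n → ℕ) (i : Fin n)
    (T : Uq a d r ≃ₐ[Kq] Uq a d r) : Prop :=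
  T (gen a d r (Gen.E i)) = -(gen a d r (Gen.F i) * gen a d r (Gen.K i)) ∧
  T (gen a d r (Gen.F i)) = -(gen a d r (Gen.Kinv i) * gen a d r (Gen.E i)) ∧
  (∀ j, T (gen a d r (Gen.K j)) = gen a d r (Gen.K j) * Kzpow a d r i (-(a i j))) ∧
  T (gen a d r Gen.g) = gen a d r Gen.g ∧
  (∀ j, j ≠ i → T (gen a d r (Gen.E j)) = TE a d r i j) ∧
  (∀ j, j ≠ i → T (gen a d r (Gen.F j)) = TF a d r i j)

/-- The stated values of the inverse braid group operator `T_i⁻¹`. -/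
def TInvCond (a : Fin n → Fin n → ℤ) (d r : Fin n → ℕ) (i : Fin n)
    (Tinv : Uq a d r ≃ₐ[Kq] Uq a d r) : Prop :=
  Tinv (gen a d r (Gen.E i)) = -(gen a d r (Gen.Kinv i) * gen a d r (Gen.F i)) ∧
  Tinv (gen a d r (Gen.F i)) = -(gen a d r (Gen.E i) * gen a d r (Gen.K i)) ∧
  (∀ j, Tinv (gen a d r (Gen.K j)) = gen a d r (Gen.K j) * Kzpow a d r i (-(a i j))) ∧
  Tinv (gen a d r Gen.g) = gen a d r Gen.g ∧
  (∀ j, j ≠ i → Tinv (gen a d r (Gen.E j)) = TEinv a d r i j) ∧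
  (∀ j, j ≠ i → Tinv (gen a d r (Gen.F j)) = TFinv a d r i j)

namespace QuantumBraid

open PowerSeries

section QExp

variable {𝕜 : Type*} [Field 𝕜] {A : Type*} [Ring A] [Algebra 𝕜 A]

/-- The coefficients `∏_{j < n} (t - 1) / (t ^ (j + 1) - 1)` of the `t`-exponential series. -/
def expCoeff (t : 𝕜) : ℕ → 𝕜
  | 0 => 1
  | n + 1 => (t - 1) / (t ^ (n + 1) - 1) * expCoeff t n

theorem expCoeff_succ {t : 𝕜} (ht : ∀ n : ℕ, t ^ (n + 1) ≠ 1) (n : ℕ) :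
    (t ^ (n + 1) - 1) * expCoeff t (n + 1) = (t - 1) * expCoeff t n := by
  have := sub_ne_zero.mpr (ht n)
  rw [expCoeff]
  field_simp

/-- The `t`-exponential series of `y`. -/
def qExp (t : 𝕜) (y : A) : A⟦X⟧ := PowerSeries.mk fun n => expCoeff t n • y ^ n

@[simp]
theorem coeff_qExp (t : 𝕜) (y : A) (n : ℕ) : coeff n (qExp t y) = expCoeff t n • y ^ n :=
  coeff_mk _ _

theorem isUnit_qExp (t : 𝕜) (y : A) : IsUnit (qExp t y) := by
  have h : constantCoeff (qExp t y) = ((1 : Aˣ) : A) := by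
    rw [← coeff_zero_eq_constantCoeff_apply, coeff_qExp]
    simp [expCoeff]
  exact ⟨⟨_, invOfUnit _ 1, mul_invOfUnit _ _ h, invOfUnit_mul _ _ h⟩, rfl⟩

theorem qExp_mul_C {t : 𝕜} (ht : ∀ n : ℕ, t ^ (n + 1) ≠ 1) (y : A) (p : A⟦X⟧)
    (hp : ∀ n, (t ^ (n + 1) - 1) • coeff (n + 1) p =
      (t - 1) • (y * coeff n p - t ^ n • (coeff n p * y))) :
    qExp t y * C (coeff 0 p) = p * qExp t y := by
  ext n
  rw [coeff_mul_C, coeff_qExp]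
  induction n with
  | zero => simp [expCoeff, coeff_mul]
  | succ n ih =>
    have h0 := sub_ne_zero.mpr (ht n)
    have key : (t ^ (n + 1) - 1) • coeff (n + 1) (p * qExp t y) =
        (t - 1) • (y * coeff n (p * qExp t y)) := by
      have e1 : (t ^ (n + 1) - 1) • coeff (n + 1) (p * qExp t y) =
          ∑ x ∈ Finset.HasAntidiagonal.antidiagonal (n + 1),
            ((t ^ x.1 - 1) • coeff x.1 p * coeff x.2 (qExp t y)) +
          ∑ x ∈ Finset.HasAntidiagonal.antidiagonal (n + 1),
            (t ^ x.1 • coeff x.1 p * ((t ^ x.2 - 1) • coeff x.2 (qExp t y))) := by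
        rw [coeff_mul, Finset.smul_sum, ← Finset.sum_add_distrib]
        refine Finset.sum_congr rfl fun x hx => ?_
        rw [← Finset.HasAntidiagonal.mem_antidiagonal.mp hx, pow_add]
        simp only [smul_mul_assoc, mul_smul_comm, smul_smul]
        module
      rw [e1, Finset.Nat.sum_antidiagonal_succ, Finset.Nat.sum_antidiagonal_succ',
        coeff_mul, Finset.mul_sum, Finset.smul_sum]
      simp only [pow_zero, sub_self, zero_smul, zero_mul, mul_zero, zero_add]
      rw [← Finset.sum_add_distrib]
      refine Finset.sum_congr rfl fun x _ => ?_
      rw [hp, coeff_qExp, coeff_qExp, smul_smul, expCoeff_succ ht, pow_succ' y]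
      simp only [smul_mul_assoc, mul_smul_comm, smul_smul, sub_mul, smul_sub, mul_assoc]
      module
    have := congrArg (fun z => (t ^ (n + 1) - 1)⁻¹ • z) key
    simp only [smul_smul, inv_mul_cancel₀ h0, one_smul] at this
    rw [this, ← ih, expCoeff, pow_succ' y]
    simp only [smul_mul_assoc, mul_smul_comm, smul_smul, mul_assoc]
    congr 1
    field_simp

end QExp

section QNum

variable {𝕜 : Type*} [Field 𝕜]

/-- The quantum integer `(q ^ z - q ^ (-z)) / (q - q⁻¹)`. -/
def qnum (q : 𝕜) (z : ℤ) : 𝕜 := (q ^ z - q ^ (-z)) / (q - q⁻¹)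

/-- `q` is nonzero and not a root of unity. -/
def Generic (q : 𝕜) : Prop := q ≠ 0 ∧ ∀ n : ℕ, q ^ (n + 1) ≠ 1

variable {q : 𝕜}

theorem Generic.inv (hq : Generic q) : Generic q⁻¹ :=
  ⟨inv_ne_zero hq.1, fun n h => hq.2 n (by rwa [inv_pow, inv_eq_one] at h)⟩

theorem Generic.zpow_ne_one (hq : Generic q) {z : ℤ} (hz : z ≠ 0) : q ^ z ≠ 1 := by
  obtain ⟨n, rfl | rfl⟩ := z.eq_nat_or_neg
  · obtain ⟨n, rfl⟩ := Nat.exists_eq_succ_of_ne_zero (n := n) (by simpa using hz)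
    exact_mod_cast hq.2 n
  · obtain ⟨n, rfl⟩ := Nat.exists_eq_succ_of_ne_zero (n := n) (by simpa using hz)
    rw [zpow_neg, Ne, inv_eq_one]
    exact_mod_cast hq.2 n

theorem Generic.zpow (hq : Generic q) {z : ℤ} (hz : z ≠ 0) : Generic (q ^ z) := by
  refine ⟨zpow_ne_zero _ hq.1, fun n => ?_⟩
  rw [← zpow_natCast, ← zpow_mul]
  exact hq.zpow_ne_one (mul_ne_zero hz (by positivity))

theorem Generic.sub_inv_ne_zero (hq : Generic q) : q - q⁻¹ ≠ 0 := by
  intro h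
  have h1 : q = q⁻¹ := sub_eq_zero.mp h
  apply hq.2 1
  rw [pow_succ, pow_one]
  nth_rewrite 2 [h1]
  exact mul_inv_cancel₀ hq.1

theorem Generic.sq_sub_one_ne_zero (hq : Generic q) : q ^ 2 - 1 ≠ 0 :=
  sub_ne_zero.mpr (hq.2 1)

theorem Generic.qnum_ne_zero (hq : Generic q) {z : ℤ} (hz : z ≠ 0) : qnum q z ≠ 0 := by
  refine div_ne_zero (fun h => ?_) hq.sub_inv_ne_zero
  apply hq.zpow_ne_one (z := z + z) (by omega)
  rw [zpow_add₀ hq.1]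
  nth_rewrite 2 [sub_eq_zero.mp h]
  rw [← zpow_add₀ hq.1, add_neg_cancel, zpow_zero]

theorem Generic.qnum_succ_ne_zero (hq : Generic q) (n : ℕ) : qnum q (n + 1) ≠ 0 :=
  hq.qnum_ne_zero (by omega)

theorem Generic.qnum_one (hq : Generic q) : qnum q 1 = 1 := by
  rw [qnum, zpow_one, zpow_neg_one, div_self hq.sub_inv_ne_zero]

@[simp]
theorem qnum_zero (q : 𝕜) : qnum q 0 = 0 := by simp [qnum]

theorem qnum_inv (q : 𝕜) (z : ℤ) : qnum q⁻¹ z = qnum q z := by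
  rw [qnum, qnum, inv_inv, inv_zpow', inv_zpow', neg_neg, ← neg_sub (q ^ z), ← neg_sub q,
    neg_div_neg_eq]

theorem qnum_mul_qnum_succ (hq : Generic q) (m n : ℤ) :
    qnum q (m - n + 1) * qnum q n + qnum q (m - 2 * n) = qnum q (m - n) * qnum q (n + 1) := by
  have h0 := hq.1
  have h1 := hq.sub_inv_ne_zero
  simp only [qnum, neg_add, neg_sub, zpow_add₀ h0, zpow_sub₀ h0, zpow_neg, zpow_one, two_mul]
  have := zpow_ne_zero m h0
  have := zpow_ne_zero n h0
  generalize q ^ m = x at *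
  generalize q ^ n = y at *
  have h2 := hq.sq_sub_one_ne_zero
  field_simp
  ring

/-- The triangular number `z (z + 1) / 2` of an integer. -/
def tri (z : ℤ) : ℤ := z * (z + 1) / 2

theorem two_mul_tri (z : ℤ) : 2 * tri z = z * (z + 1) :=
  Int.mul_ediv_cancel' (Int.even_mul_succ_self z).two_dvd

theorem tri_add (y z : ℤ) : tri (y + z) = tri y + tri z + y * z := by
  have h1 := two_mul_tri y
  have h2 := two_mul_tri z
  have h3 := two_mul_tri (y + z)
  have : 2 * tri (y + z) = 2 * (tri y + tri z + y * z) := by rw [h3]; linear_combination -h1 - h2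
  omega

end QNum

section RankOne

variable {𝕜 : Type*} [Field 𝕜] {A : Type*} [Ring A] [Algebra 𝕜 A]

/-- `x` has weight `w` for the conjugation action of the unit `k`. -/
def HasWt (q : 𝕜) (k : Aˣ) (w : ℤ) (x : A) : Prop := ↑k * x = q ^ w • (x * ↑k)

/-- `e, f, k` satisfy the defining relations of the quantized enveloping algebra of `sl₂`. -/
structure IsQuantumSl2 (q : 𝕜) (e f : A) (k : Aˣ) : Prop where
  generic : Generic q
  wt_e : HasWt q k 2 e
  wt_f : HasWt q k (-2) f
  lie : e * f - f * e = (q - q⁻¹)⁻¹ • ((k : A) - ↑k⁻¹)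

variable {q : 𝕜} {e f v x y : A} {k : Aˣ} {w w' : ℤ}

theorem HasWt.mul (hq : q ≠ 0) (hx : HasWt q k w x) (hy : HasWt q k w' y) :
    HasWt q k (w + w') (x * y) := by
  rw [HasWt] at *
  rw [← mul_assoc, hx, smul_mul_assoc, mul_assoc, hy, mul_smul_comm, smul_smul, zpow_add₀ hq,
    mul_assoc]

theorem HasWt.add (hx : HasWt q k w x) (hy : HasWt q k w y) : HasWt q k w (x + y) := by
  rw [HasWt] at *
  rw [mul_add, hx, hy, add_mul, smul_add]

theorem HasWt.smul (c : 𝕜) (hx : HasWt q k w x) : HasWt q k w (c • x) := by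
  rw [HasWt] at *
  rw [mul_smul_comm, hx, smul_mul_assoc, smul_comm]

theorem HasWt.neg (hx : HasWt q k w x) : HasWt q k w (-x) := by
  simpa using hx.smul (-1)

theorem HasWt.sub (hx : HasWt q k w x) (hy : HasWt q k w y) : HasWt q k w (x - y) := by
  simpa [sub_eq_add_neg] using hx.add hy.neg

theorem HasWt.of_commute (h : Commute (k : A) x) : HasWt q k 0 x := by
  rw [HasWt, zpow_zero, one_smul]
  exact h

theorem HasWt.pow (hq : q ≠ 0) (hx : HasWt q k w x) (n : ℕ) : HasWt q k (n * w) (x ^ n) := by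
  induction n with
  | zero => simpa using HasWt.of_commute (Commute.one_right _)
  | succ n ih =>
    have := ih.mul hq hx
    rw [pow_succ]
    convert this using 1
    push_cast
    ring

theorem HasWt.units_zpow (hq : q ≠ 0) (hx : HasWt q k w x) (z : ℤ) :
    ↑(k ^ z) * x = q ^ (w * z) • (x * ↑(k ^ z)) := by
  have h1 : (k⁻¹ : Aˣ) * x = q ^ (-w) • (x * ↑k⁻¹) := by
    rw [HasWt] at hx
    calc (k⁻¹ : Aˣ) * x = q ^ (-w) • (↑k⁻¹ * (q ^ w • (x * ↑k)) * ↑k⁻¹) := by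
          simp [smul_smul, mul_assoc, inv_mul_cancel₀ (zpow_ne_zero w hq)]
      _ = _ := by rw [← hx]; simp
  induction z with
  | zero => simp
  | succ n ih =>
    rw [zpow_add_one, Units.val_mul, mul_assoc, hx, mul_smul_comm, ← mul_assoc, ih,
      smul_mul_assoc, smul_smul, mul_add, zpow_add₀ hq, mul_one, mul_comm (q ^ w), mul_assoc]
  | pred n ih =>
    rw [zpow_sub_one, Units.val_mul, mul_assoc, h1, mul_smul_comm, ← mul_assoc, ih,
      smul_mul_assoc, smul_smul, mul_sub, zpow_sub₀ hq, mul_one, zpow_neg, div_eq_mul_inv,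
      mul_comm _ (q ^ w)⁻¹, mul_assoc]

theorem HasWt.units_inv (hq : q ≠ 0) (hx : HasWt q k w x) :
    (↑k⁻¹ : A) * x = q ^ (-w) • (x * ↑k⁻¹) := by
  simpa using hx.units_zpow hq (-1)

theorem hasWt_zpow (q : 𝕜) (k : Aˣ) (z : ℤ) : HasWt q k 0 (↑(k ^ z) : A) :=
  HasWt.of_commute (show (k : A) * ↑(k ^ z) = ↑(k ^ z) * ↑k by
    simpa only [Units.val_mul] using congrArg Units.val ((Commute.refl k).zpow_right z).eq)

/-- The quantum divided powers of the adjoint action of `e` on a vector `v` of weight `-m`. -/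
def adj (q : 𝕜) (e : A) (m : ℕ) (v : A) : ℕ → A
  | 0 => v
  | n + 1 => (qnum q (n + 1))⁻¹ • (e * adj q e m v n - q ^ (2 * n - m : ℤ) • (adj q e m v n * e))

@[simp]
theorem adj_zero (q : 𝕜) (e : A) (m : ℕ) (v : A) : adj q e m v 0 = v := rfl

theorem qnum_smul_adj_succ (hq : Generic q) (e : A) (m : ℕ) (v : A) (n : ℕ) :
    qnum q (n + 1) • adj q e m v (n + 1) =
      e * adj q e m v n - q ^ (2 * n - m : ℤ) • (adj q e m v n * e) := by
  rw [adj, smul_smul, mul_inv_cancel₀ (hq.qnum_succ_ne_zero n), one_smul]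

theorem e_mul_adj (hq : Generic q) (e : A) (m : ℕ) (v : A) (n : ℕ) :
    e * adj q e m v n = qnum q (n + 1) • adj q e m v (n + 1) +
      q ^ (2 * n - m : ℤ) • (adj q e m v n * e) := by
  rw [qnum_smul_adj_succ hq, sub_add_cancel]

theorem adj_eq_zero_of_le {m n n' : ℕ} (h : adj q e m v n = 0) (hn : n ≤ n') :
    adj q e m v n' = 0 := by
  induction n', hn using Nat.le_induction with
  | base => exact h
  | succ n' _ ih => simp [adj, ih]

theorem map_adj {B : Type*} [Ring B] [Algebra 𝕜 B] (φ : A →ₐ[𝕜] B) (q : 𝕜) (e : A) (m : ℕ)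
    (v : A) (n : ℕ) : φ (adj q e m v n) = adj q (φ e) m (φ v) n := by
  induction n with
  | zero => rfl
  | succ n ih => simp [adj, ih]

namespace IsQuantumSl2

variable (h : IsQuantumSl2 q e f k)
include h

theorem wt_adj {m : ℕ} (hv : HasWt q k (-m) v) (n : ℕ) :
    HasWt q k (2 * n - m) (adj q e m v n) := by
  induction n with
  | zero => simpa using hv
  | succ n ih =>
    refine HasWt.smul _ (HasWt.sub ?_ (HasWt.smul _ ?_))
    · convert h.wt_e.mul h.generic.1 ih using 1
      push_cast
      ring
    · convert ih.mul h.generic.1 h.wt_e using 1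
      push_cast
      ring

theorem f_mul_adj_succ {m : ℕ} (hv : HasWt q k (-m) v) (hf : f * v = v * f) (n : ℕ) :
    f * adj q e m v (n + 1) = adj q e m v (n + 1) * f +
      qnum q (m - n) • (adj q e m v n * ↑k⁻¹) := by
  have hq := h.generic.1
  have hfe : f * e = e * f - (q - q⁻¹)⁻¹ • ((k : A) - ↑k⁻¹) := by rw [← h.lie]; abel
  have main : ∀ n : ℕ, ∀ u : A, f * adj q e m v n = adj q e m v n * f + qnum q (m - n + 1) • u →
      e * u - q ^ (2 * n - m : ℤ) • (u * e) = qnum q n • (adj q e m v n * ↑k⁻¹) →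
      f * adj q e m v (n + 1) = adj q e m v (n + 1) * f +
        qnum q (m - n) • (adj q e m v n * ↑k⁻¹) := by
    intro n u h1 h2
    have h3 := h.wt_adj hv n
    have h4 := h3.units_inv hq
    rw [HasWt] at h3
    have goal : qnum q (n + 1) • (f * adj q e m v (n + 1)) = qnum q (n + 1) •
        (adj q e m v (n + 1) * f + qnum q (m - n) • (adj q e m v n * ↑k⁻¹)) := by
      rw [smul_add, ← mul_smul_comm, ← smul_mul_assoc (qnum q (n + 1)) (adj q e m v (n + 1)),
        qnum_smul_adj_succ h.generic, smul_smul]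
      have e1 : f * (e * adj q e m v n) = e * adj q e m v n * f + qnum q (m - n + 1) • (e * u) -
          (q - q⁻¹)⁻¹ • (q ^ (2 * n - m : ℤ) • (adj q e m v n * ↑k) -
            q ^ (-(2 * n - m) : ℤ) • (adj q e m v n * ↑k⁻¹)) := by
        rw [← mul_assoc, hfe, sub_mul, mul_assoc, h1, smul_mul_assoc, sub_mul, h3, h4, mul_add,
          mul_smul_comm, mul_assoc]
      have e2 : f * (adj q e m v n * e) = adj q e m v n * e * f -
          (q - q⁻¹)⁻¹ • (adj q e m v n * ↑k - adj q e m v n * ↑k⁻¹) +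
            qnum q (m - n + 1) • (u * e) := by
        rw [← mul_assoc, h1, add_mul, mul_assoc, hfe, mul_sub, mul_smul_comm, mul_sub,
          smul_mul_assoc, mul_assoc]
      have e3 : qnum q (m - n + 1) * qnum q n + (q - q⁻¹)⁻¹ * (q ^ (-(2 * n - m) : ℤ) -
          q ^ (2 * n - m : ℤ)) = qnum q (n + 1) * qnum q (m - n) := by
        rw [mul_comm (qnum q (n + 1)), ← qnum_mul_qnum_succ h.generic, show qnum q (m - 2 * n) =
            (q ^ (m - 2 * n : ℤ) - q ^ (-(m - 2 * n) : ℤ)) / (q - q⁻¹) from rfl, neg_sub, neg_sub]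
        ring
      rw [mul_sub, mul_smul_comm, e1, e2, ← e3, add_smul, mul_smul, ← h2, sub_mul,
        smul_mul_assoc]
      module
    have := congrArg (fun z => (qnum q (n + 1))⁻¹ • z) goal
    simpa only [smul_smul, inv_mul_cancel₀ (h.generic.qnum_succ_ne_zero n), one_smul] using this
  induction n with
  | zero => exact main 0 0 (by simpa using hf) (by simp)
  | succ n ih =>
    refine main (n + 1) (adj q e m v n * ↑k⁻¹) ?_ ?_
    · rw [ih]
      push_cast
      congr 3
      ring
    · have h5 := h.wt_e.units_inv hq
      rw [mul_assoc _ (↑k⁻¹ : A) e, h5, ← mul_assoc, e_mul_adj h.generic]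
      simp only [add_mul, smul_mul_assoc, mul_smul_comm, mul_assoc, smul_smul, ← zpow_add₀ hq]
      push_cast
      have : (2 * ((n : ℤ) + 1) - m + -2) = 2 * n - m := by ring
      rw [this]
      abel

end IsQuantumSl2

end RankOne

section Lift

open Polynomial (reflect)

variable {𝕜 : Type*} [Field 𝕜] {A : Type*} [Ring A] [Algebra 𝕜 A]

/-- The element `x`, of weight `w`, multiplied by `k ^ w` and suitably normalised. -/
def twist (q : 𝕜) (k : Aˣ) (w : ℤ) (x : A) : A := ((-1) ^ w * q ^ tri w) • (x * ↑(k ^ w))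

/-- `r` and `p` describe the conjugates of `x` by two `q`-exponentials, and `s` is the polynomial
which corresponds to `p` under conjugation by a third one, after reversing the polynomials. -/
structure Lift (q : 𝕜) (e f : A) (k : Aˣ) (w : ℤ) (x : A) (r s p : Polynomial A) (N M : ℕ) :
    Prop where
  wt : HasWt q k w x
  deg_s : s.natDegree ≤ N
  deg_p : p.natDegree ≤ M
  shift : (M : ℤ) = N - w
  conj_twist : qExp (q ^ (2 : ℤ)) (q • (e * ↑k)) * C (twist q k w x) =
    (p : A⟦X⟧) * qExp (q ^ (2 : ℤ)) (q • (e * ↑k))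
  conj_self : qExp (q ^ (-2 : ℤ)) (q • f) * C x = (r : A⟦X⟧) * qExp (q ^ (-2 : ℤ)) (q • f)
  link : qExp (q ^ (-2 : ℤ)) f * (reflect N s : A⟦X⟧) =
    (reflect M p : A⟦X⟧) * qExp (q ^ (-2 : ℤ)) f

variable {q : 𝕜} {e f x y : A} {k : Aˣ} {w w' : ℤ} {r s p r' s' p' : Polynomial A}
  {N M N' M' : ℕ}

theorem twist_mul (hq : q ≠ 0) (hy : HasWt q k w' y) :
    twist q k (w + w') (x * y) = twist q k w x * twist q k w' y := by
  have hm : (-1 : 𝕜) ≠ 0 := by simp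
  have h1 : x * ↑(k ^ w) * (y * ↑(k ^ w')) = q ^ (w' * w) • (x * y * ↑(k ^ (w + w'))) := by
    rw [mul_assoc, ← mul_assoc _ y, hy.units_zpow hq, smul_mul_assoc, mul_smul_comm, zpow_add,
      Units.val_mul]
    simp only [mul_assoc]
  simp only [twist, smul_mul_assoc, mul_smul_comm, h1, smul_smul, zpow_add₀ hm, tri_add,
    zpow_add₀ hq, mul_comm w' w]
  congr 1
  ring

theorem twist_add (q : 𝕜) (k : Aˣ) (w : ℤ) (x y : A) :
    twist q k w (x + y) = twist q k w x + twist q k w y := by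
  rw [twist, add_mul, smul_add]
  rfl

@[simp]
theorem twist_one (q : 𝕜) (k : Aˣ) : twist q k 0 1 = 1 := by
  simp [twist, tri]

namespace Lift

theorem mul (hq : q ≠ 0) (h : Lift q e f k w x r s p N M) (h' : Lift q e f k w' y r' s' p' N' M') :
    Lift q e f k (w + w') (x * y) (r * r') (s * s') (p * p') (N + N') (M + M') where
  wt := h.wt.mul hq h'.wt
  deg_s := Polynomial.natDegree_mul_le_of_le h.deg_s h'.deg_s
  deg_p := Polynomial.natDegree_mul_le_of_le h.deg_p h'.deg_p
  shift := by
    have := h.shift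
    have := h'.shift
    push_cast
    omega
  conj_twist := by
    rw [twist_mul hq h'.wt, map_mul, ← mul_assoc, h.conj_twist, mul_assoc, h'.conj_twist,
      ← mul_assoc, Polynomial.coe_mul]
  conj_self := by
    rw [map_mul, ← mul_assoc, h.conj_self, mul_assoc, h'.conj_self, ← mul_assoc,
      Polynomial.coe_mul]
  link := by
    rw [Polynomial.reflect_mul _ _ h.deg_s h'.deg_s, Polynomial.reflect_mul _ _ h.deg_p h'.deg_p,
      Polynomial.coe_mul, ← mul_assoc, h.link, mul_assoc, h'.link, ← mul_assoc,
      Polynomial.coe_mul]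

theorem one (q : 𝕜) (e f : A) (k : Aˣ) (j : ℕ) : Lift q e f k 0 1 1 1 1 j j where
  wt := HasWt.of_commute (Commute.one_right _)
  deg_s := by simp
  deg_p := by simp
  shift := by simp
  conj_twist := by simp
  conj_self := by simp
  link := by
    rw [Polynomial.reflect_one, Polynomial.coe_pow, Polynomial.coe_X]
    exact commute_X_pow _ _

theorem scalar (q : 𝕜) (e f : A) (k : Aˣ) (c : 𝕜) :
    Lift q e f k 0 (algebraMap 𝕜 A c) (Polynomial.C (algebraMap 𝕜 A c))
      (Polynomial.C (algebraMap 𝕜 A c)) (Polynomial.C (algebraMap 𝕜 A c)) 0 0 where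
  wt := HasWt.of_commute (Algebra.commutes c _).symm
  deg_s := by simp
  deg_p := by simp
  shift := by simp
  conj_twist := by
    ext n
    simp [twist, tri, coeff_mul_C, coeff_C_mul, ← Algebra.commutes c]
  conj_self := by
    ext n
    simp [coeff_mul_C, coeff_C_mul, ← Algebra.commutes c]
  link := by
    ext n
    simp [coeff_mul_C, coeff_C_mul, ← Algebra.commutes c]

theorem raise (hq : q ≠ 0) (h : Lift q e f k w x r s p N M) (j : ℕ) :
    Lift q e f k w x r s p (N + j) (M + j) := by
  simpa using h.mul hq (one q e f k j)

theorem add' (h : Lift q e f k w x r s p N M) (h' : Lift q e f k w y r' s' p' N M) :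
    Lift q e f k w (x + y) (r + r') (s + s') (p + p') N M where
  wt := h.wt.add h'.wt
  deg_s := (Polynomial.natDegree_add_le _ _).trans (max_le h.deg_s h'.deg_s)
  deg_p := (Polynomial.natDegree_add_le _ _).trans (max_le h.deg_p h'.deg_p)
  shift := h.shift
  conj_twist := by
    rw [twist_add, map_add, mul_add, h.conj_twist, h'.conj_twist, Polynomial.coe_add, add_mul]
  conj_self := by
    rw [map_add, mul_add, h.conj_self, h'.conj_self, Polynomial.coe_add, add_mul]
  link := by
    rw [Polynomial.reflect_add, Polynomial.reflect_add, Polynomial.coe_add, Polynomial.coe_add,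
      mul_add, add_mul, h.link, h'.link]

theorem add (hq : q ≠ 0) (h : Lift q e f k w x r s p N M)
    (h' : Lift q e f k w y r' s' p' N' M') :
    Lift q e f k w (x + y) (r + r') (s + s') (p + p') (N + N') (M + N') := by
  have h1 := h.raise hq N'
  have h2 := h'.raise hq N
  have e1 := h.shift
  have e2 := h'.shift
  rw [add_comm N' N, show M' + N = M + N' by omega] at h2
  exact h1.add' h2

/-- The polynomials attached to `x` are determined by `x`. -/
theorem unique (hq : q ≠ 0) (h : Lift q e f k w x r s p N M)
    (h' : Lift q e f k w x r' s' p' N' M') : r = r' ∧ s = s' := by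
  have hr : r = r' := by
    have := h.conj_self.symm.trans h'.conj_self
    exact Polynomial.coe_injective A ((isUnit_qExp _ _).mul_right_cancel this)
  have hp : p = p' := by
    have := h.conj_twist.symm.trans h'.conj_twist
    exact Polynomial.coe_injective A ((isUnit_qExp _ _).mul_right_cancel this)
  refine ⟨hr, ?_⟩
  have h1 := (h.raise hq N').link
  have h2 := (h'.raise hq N).link
  have e1 := h.shift
  have e2 := h'.shift
  rw [add_comm N' N, show M' + N = M + N' by omega, ← hp] at h2
  have h3 := (isUnit_qExp _ _).mul_left_cancel (h1.trans h2.symm)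
  ext n
  simpa [Polynomial.coeff_reflect] using
    congrArg (fun g => g.coeff (Polynomial.revAt (N + N') n)) (Polynomial.coe_injective A h3)

theorem coeff_zero (h : Lift q e f k w x r s p N M) : r.coeff 0 = x := by
  have := congrArg (coeff 0) h.conj_self
  simpa [coeff_mul, expCoeff] using this.symm

end Lift

/-- `(-1) ^ m` times the `m`-th quantum divided power of the adjoint action of `e`. -/
def adjTop (q : 𝕜) (e : A) (m : ℕ) (v : A) : A := (-1 : 𝕜) ^ m • adj q e m v m

theorem tri_succ (z : ℤ) : tri (z + 1) = tri z + z + 1 := by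
  rw [tri_add, show tri 1 = 1 from rfl]
  ring

variable {v : A} {m : ℕ}

/-- The polynomial attached to a lowest weight vector of weight `-m`. -/
def lowestPoly (q : 𝕜) (e : A) (k : Aˣ) (m : ℕ) (v : A) : Polynomial A :=
  ∑ n ∈ Finset.range (m + 1), Polynomial.monomial n
    (((-1) ^ m * q ^ tri (n - m)) • (adj q e m v n * ↑(k ^ (n - m : ℤ))))

theorem coeff_lowestPoly (h0 : adj q e m v (m + 1) = 0) (n : ℕ) :
    (lowestPoly q e k m v).coeff n =
      ((-1) ^ m * q ^ tri (n - m)) • (adj q e m v n * ↑(k ^ (n - m : ℤ))) := by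
  rw [lowestPoly, Polynomial.finsetSum_coeff]
  simp only [Polynomial.coeff_monomial]
  rw [Finset.sum_ite_eq' (Finset.range (m + 1)) n]
  split_ifs with h
  · rfl
  · rw [adj_eq_zero_of_le h0 (by simpa using h)]
    simp

theorem natDegree_lowestPoly_le : (lowestPoly q e k m v).natDegree ≤ m := by
  refine Polynomial.natDegree_sum_le_of_forall_le _ _ fun n hn => ?_
  exact (Polynomial.natDegree_monomial_le _).trans (Nat.lt_succ_iff.mp (Finset.mem_range.mp hn))

theorem Generic.sq_pow_ne_one (hq : Generic q) (n : ℕ) : (q ^ (2 : ℤ)) ^ (n + 1) ≠ 1 :=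
  (hq.zpow two_ne_zero).2 n

theorem Generic.inv_sq_pow_ne_one (hq : Generic q) (n : ℕ) : (q ^ (-2 : ℤ)) ^ (n + 1) ≠ 1 :=
  (hq.zpow (by norm_num)).2 n

/-- A form of `qExp_mul_C` for exponentials in `q ^ 2`. -/
theorem qExp_sq_mul_C (hq : Generic q) (y : A) (p : A⟦X⟧)
    (hp : ∀ n : ℕ, (q ^ (n + 1 : ℤ) * qnum q (n + 1)) • coeff (n + 1) p =
      q • (y * coeff n p - q ^ (2 * n : ℤ) • (coeff n p * y))) :
    qExp (q ^ (2 : ℤ)) y * C (coeff 0 p) = p * qExp (q ^ (2 : ℤ)) y := by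
  refine qExp_mul_C hq.sq_pow_ne_one y p fun n => ?_
  have h0 := hq.1
  have hd := hq.sub_inv_ne_zero
  have e1 : (q ^ (2 : ℤ)) ^ (n + 1) - 1 = (q - q⁻¹) * (q ^ (n + 1 : ℤ) * qnum q (n + 1)) := by
    rw [qnum, mul_div_assoc', mul_div_cancel₀ _ hd, mul_sub, ← zpow_add₀ h0, ← zpow_add₀ h0,
      ← zpow_natCast, ← zpow_mul, add_neg_cancel, zpow_zero]
    congr 2
    push_cast
    ring
  have e2 : q ^ (2 : ℤ) - 1 = (q - q⁻¹) * q := by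
    rw [sub_mul, inv_mul_cancel₀ h0, zpow_two]
  have e3 : (q ^ (2 : ℤ)) ^ n = q ^ (2 * n : ℤ) := by
    rw [zpow_mul, zpow_natCast]
  rw [e1, e2, e3, mul_smul, hp, mul_smul]

/-- A form of `qExp_mul_C` for exponentials in `q ^ (-2)`. -/
theorem qExp_inv_sq_mul_C (hq : Generic q) (y : A) (p : A⟦X⟧)
    (hp : ∀ n : ℕ, qnum q (n + 1) • coeff (n + 1) p =
      q ^ (n : ℤ) • (y * coeff n p - q ^ (-2 * n : ℤ) • (coeff n p * y))) :
    qExp (q ^ (-2 : ℤ)) y * C (coeff 0 p) = p * qExp (q ^ (-2 : ℤ)) y := by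
  have h0 := hq.1
  have := qExp_sq_mul_C hq.inv y p fun n => ?_
  · simpa only [inv_zpow', neg_neg] using this
  · rw [qnum_inv, mul_smul, hp, smul_smul, inv_zpow', inv_zpow', ← zpow_add₀ h0, ← zpow_neg_one]
    congr 3
    all_goals ring_nf

/-- The lift of a lowest weight vector. -/
theorem IsQuantumSl2.lift_lowest (h : IsQuantumSl2 q e f k) (hv : HasWt q k (-m) v)
    (hf : f * v = v * f) (h0 : adj q e m v (m + 1) = 0) :
    Lift q e f k (-m) v (Polynomial.C v) (Polynomial.C (adjTop q e m v))
      (lowestPoly q e k m v) 0 m where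
  wt := hv
  deg_s := by simp
  deg_p := natDegree_lowestPoly_le
  shift := by simp
  conj_twist := by
    have hq := h.generic
    have e0 : twist q k (-m) v = coeff 0 (lowestPoly q e k m v : A⟦X⟧) := by
      rw [Polynomial.coeff_coe, coeff_lowestPoly h0, twist]
      simp [← inv_pow]
    rw [e0]
    refine qExp_sq_mul_C hq _ _ fun n => ?_
    have h1 := h.wt_adj hv n
    rw [HasWt] at h1
    have h2 := h.wt_e.units_zpow hq.1 (n - m)
    have k1 : (k : A) * ↑(k ^ (n - m : ℤ)) = ↑(k ^ (n - m + 1 : ℤ)) := by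
      rw [add_comm _ (1 : ℤ), zpow_one_add, Units.val_mul]
    have k2 : (↑(k ^ (n - m : ℤ)) : A) * k = ↑(k ^ (n - m + 1 : ℤ)) := by
      rw [zpow_add_one, Units.val_mul]
    have e1 : q • (e * ↑k) * (adj q e m v n * ↑(k ^ (n - m : ℤ))) =
        (q * q ^ (2 * n - m : ℤ)) • (e * adj q e m v n * ↑(k ^ (n - m + 1 : ℤ))) := by
      rw [smul_mul_assoc, mul_assoc e, ← mul_assoc (k : A), h1, smul_mul_assoc, mul_assoc _ (k : A),
        k1, mul_smul_comm, smul_smul, mul_assoc]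
    have e2 : adj q e m v n * ↑(k ^ (n - m : ℤ)) * q • (e * ↑k) =
        (q * q ^ (2 * (n - m) : ℤ)) • (adj q e m v n * e * ↑(k ^ (n - m + 1 : ℤ))) := by
      rw [mul_smul_comm, mul_assoc, ← mul_assoc _ e, h2, smul_mul_assoc, mul_assoc e, k2,
        mul_smul_comm, smul_smul, mul_assoc]
    simp only [Polynomial.coeff_coe, coeff_lowestPoly h0]
    rw [Nat.cast_succ, add_sub_right_comm, tri_succ, mul_smul_comm _ (q • (e * (k : A))), e1,
      smul_mul_assoc _ _ (q • (e * (k : A))), e2, mul_smul, smul_comm (qnum q _), ← smul_mul_assoc,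
      qnum_smul_adj_succ hq, sub_mul, smul_mul_assoc]
    have hn := zpow_ne_zero (n : ℤ) hq.1
    have hm := zpow_ne_zero (m : ℤ) hq.1
    have h00 := hq.1
    simp only [two_mul, zpow_add₀ h00, zpow_sub₀ h00, zpow_one, smul_sub, smul_smul]
    congr 2
    · field_simp
    · field_simp
  conj_self := by
    ext n
    have : Commute v (f ^ n) := (show Commute v f from hf.symm).pow_right n
    simp [coeff_mul_C, coeff_C_mul, smul_pow, this.eq]
  link := by
    have hq := h.generic
    have hc (n : ℕ) : (reflect m (lowestPoly q e k m v)).coeff n = if n ≤ m then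
        ((-1) ^ m * q ^ tri (-n)) • (adj q e m v (m - n) * ↑(k ^ (-n : ℤ))) else 0 := by
      rw [Polynomial.coeff_reflect]
      split_ifs with hn
      · rw [Polynomial.revAt_le hn, coeff_lowestPoly h0, Nat.cast_sub hn, sub_sub_cancel_left]
      · rw [Polynomial.revAt_eq_self_of_lt (by omega)]
        exact Polynomial.coeff_eq_zero_of_natDegree_lt
          (natDegree_lowestPoly_le.trans_lt (by omega))
    have e0 : reflect 0 (Polynomial.C (adjTop q e m v)) =
        Polynomial.C (coeff 0 (reflect m (lowestPoly q e k m v) : A⟦X⟧)) := by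
      rw [Polynomial.coeff_coe, hc]
      simp [adjTop, tri]
    rw [e0, Polynomial.coe_C]
    refine qExp_inv_sq_mul_C hq _ _ fun n => ?_
    simp only [Polynomial.coeff_coe, hc]
    have h2 := h.wt_f.units_zpow hq.1 (-n)
    have e2 (u : A) : q ^ (-2 * n : ℤ) • (u * ↑(k ^ (-n : ℤ)) * f) = u * f * ↑(k ^ (-n : ℤ)) := by
      rw [mul_assoc, h2, mul_smul_comm, smul_smul, ← zpow_add₀ hq.1, mul_assoc]
      simp
    obtain hn | hn := le_or_gt n m
    · rw [if_pos hn, smul_mul_assoc, smul_comm (q ^ (-2 * n : ℤ)), e2, mul_smul_comm, ← smul_sub,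
        ← mul_assoc, ← sub_mul]
      obtain hn | rfl := hn.lt_or_eq
      · obtain ⟨j, rfl⟩ := Nat.exists_eq_add_of_lt hn
        have e3 : (n + j + 1 : ℕ) - (j : ℤ) = n + 1 := by
          push_cast
          ring
        have e4 : (↑k⁻¹ : A) * ↑(k ^ (-n : ℤ)) = ↑(k ^ (-(n + 1) : ℤ)) := by
          rw [← Units.val_mul, ← zpow_neg_one, ← zpow_add]
          congr 2
          ring
        rw [if_pos (by omega), show n + j + 1 - n = j + 1 by omega,
          show n + j + 1 - (n + 1) = j by omega, h.f_mul_adj_succ hv hf j, add_sub_cancel_left,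
          e3, Nat.cast_succ, smul_mul_assoc, mul_assoc _ (↑k⁻¹ : A), e4, smul_smul, smul_smul,
          smul_smul, neg_add, tri_add, show tri (-1) = 0 from rfl, add_zero, neg_mul_neg, mul_one,
          zpow_add₀ hq.1]
        congr 1
        ring
      · simp [hf]
    · rw [if_neg (by omega), if_neg (by omega)]
      simp

end Lift

section LiftGenerators

open Polynomial (reflect)

variable {𝕜 : Type*} [Field 𝕜] {A : Type*} [Ring A] [Algebra 𝕜 A]
  {q : 𝕜} {e f : A} {k : Aˣ}

theorem IsQuantumSl2.e_mul_f_pow (h : IsQuantumSl2 q e f k) (n : ℕ) :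
    e * f ^ (n + 1) = f ^ (n + 1) * e + (qnum q (n + 1) * (q - q⁻¹)⁻¹) •
      (q ^ (-n : ℤ) • (f ^ n * ↑k) - q ^ (n : ℤ) • (f ^ n * ↑k⁻¹)) := by
  have hq := h.generic.1
  have h1 := h.wt_f
  have h2 := h.wt_f.units_inv hq
  rw [HasWt] at h1
  have hlie : e * f = f * e + (q - q⁻¹)⁻¹ • ((k : A) - ↑k⁻¹) := by rw [← h.lie]; abel
  induction n with
  | zero => simp [hlie, h.generic.qnum_one]
  | succ n ih =>
    rw [pow_succ f (n + 1), ← mul_assoc, ih, add_mul, mul_assoc _ e, hlie, smul_mul_assoc, sub_mul,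
      smul_mul_assoc, smul_mul_assoc, mul_assoc _ (k : A), h1, mul_assoc _ (↑k⁻¹ : A), h2,
      mul_smul_comm, mul_smul_comm, ← mul_assoc, ← mul_assoc, ← pow_succ, mul_add, mul_smul_comm,
      mul_sub, ← mul_assoc, add_assoc]
    congr 1
    have hd := h.generic.sub_inv_ne_zero
    have hn := zpow_ne_zero (n : ℤ) hq
    match_scalars
    all_goals
      simp only [qnum, neg_add, zpow_add₀ hq, zpow_neg, zpow_one, zpow_two]
      generalize q ^ (n : ℤ) = x at *
      have h2 := h.generic.sq_sub_one_ne_zero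
      field_simp
      ring

theorem expCoeff_inv_sq (hq : Generic q) (n : ℕ) :
    qnum q (n + 1) * expCoeff (q ^ (-2 : ℤ)) (n + 1) =
      q ^ (n : ℤ) * expCoeff (q ^ (-2 : ℤ)) n := by
  have h := expCoeff_succ hq.inv_sq_pow_ne_one n
  have h0 := hq.1
  have hd := hq.sub_inv_ne_zero
  have e1 : (q ^ (-2 : ℤ)) ^ (n + 1) - 1 =
      -(q - q⁻¹) * (q ^ (-(n + 1) : ℤ) * qnum q (n + 1)) := by
    have e (x y : 𝕜) : -(q - q⁻¹) * (x * (y / (q - q⁻¹))) = -(x * y) := by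
      rw [mul_left_comm, neg_mul, mul_div_cancel₀ _ hd, mul_neg]
    rw [← zpow_natCast, ← zpow_mul, qnum, e, mul_sub,
      ← zpow_add₀ h0, ← zpow_add₀ h0, neg_add_cancel, zpow_zero, neg_sub]
    congr 2
    push_cast
    ring
  have e2 : q ^ (-2 : ℤ) - 1 = -(q - q⁻¹) * q⁻¹ := by
    rw [zpow_neg, zpow_two]
    field_simp
    ring
  rw [e1, e2, mul_assoc, mul_assoc (-(q - q⁻¹))] at h
  have h' := mul_left_cancel₀ (neg_ne_zero.mpr hd) h
  rw [zpow_neg, zpow_add₀ h0, zpow_one] at h'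
  have hn := zpow_ne_zero (n : ℤ) h0
  generalize expCoeff (q ^ (-2 : ℤ)) = c at *
  field_simp at h'
  exact h'

/-- The polynomial with coefficients `a`, `b`, `c`. -/
def quad (a b c : A) : Polynomial A :=
  Polynomial.C a + Polynomial.C b * Polynomial.X + Polynomial.C c * Polynomial.X ^ 2

@[simp]
theorem coeff_quad_zero (a b c : A) : (quad a b c).coeff 0 = a := by
  simp [quad]

@[simp]
theorem coeff_quad_one (a b c : A) : (quad a b c).coeff 1 = b := by
  simp [quad, Polynomial.coeff_X_pow, Polynomial.coeff_C]

@[simp]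
theorem coeff_quad_two (a b c : A) : (quad a b c).coeff 2 = c := by
  simp [quad]

@[simp]
theorem coeff_quad_add_three (a b c : A) (n : ℕ) : (quad a b c).coeff (n + 3) = 0 := by
  simp [quad]

theorem natDegree_quad_le (a b c : A) : (quad a b c).natDegree ≤ 2 :=
  Polynomial.natDegree_le_iff_coeff_eq_zero.mpr fun n hn => by
    obtain ⟨n, rfl⟩ := Nat.exists_eq_add_of_lt hn
    rw [show 2 + n + 1 = n + 3 by ring, coeff_quad_add_three]

theorem reflect_quad (a b c : A) : reflect 2 (quad a b c) = quad c b a := by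
  ext n
  rw [Polynomial.coeff_reflect]
  obtain _ | _ | _ | n := n
  · simp [Polynomial.revAt_le]
  · simp [Polynomial.revAt_le]
  · simp [Polynomial.revAt_le]
  · rw [Polynomial.revAt_eq_self_of_lt (by omega)]
    simp

theorem map_quad {B : Type*} [Ring B] (φ : A →+* B) (a b c : A) :
    (quad a b c).map φ = quad (φ a) (φ b) (φ c) := by
  simp [quad]

theorem qExp_sq_conj_quad (hq : Generic q) {y a b c : A} (h1 : b = y * a - a * y)
    (h2 : (q * qnum q 2) • c = y * b - q ^ (2 : ℤ) • (b * y))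
    (h3 : y * c = q ^ (4 : ℤ) • (c * y)) :
    qExp (q ^ (2 : ℤ)) y * C a = (quad a b c : A⟦X⟧) * qExp (q ^ (2 : ℤ)) y := by
  have := qExp_sq_mul_C hq y (quad a b c : Polynomial A) fun n => ?_
  · simpa using this
  · simp only [Polynomial.coeff_coe]
    obtain _ | _ | _ | n := n
    · simp [hq.qnum_one, h1]
    · have e1 : q ^ (((0 + 1 : ℕ) : ℤ) + 1) * qnum q ((0 + 1 : ℕ) + 1) = q * (q * qnum q 2) := by
        norm_num
        rw [← mul_assoc, ← pow_two]
      rw [e1, mul_smul]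
      simp only [zero_add, coeff_quad_one, Nat.reduceAdd, coeff_quad_two, h2]
      simp
    · simp [h3]
    · simp

theorem qExp_inv_sq_conj_quad (hq : Generic q) {y a b c : A} (h1 : b = y * a - a * y)
    (h2 : (q⁻¹ * qnum q 2) • c = y * b - q ^ (-2 : ℤ) • (b * y))
    (h3 : y * c = q ^ (-4 : ℤ) • (c * y)) :
    qExp (q ^ (-2 : ℤ)) y * C a = (quad a b c : A⟦X⟧) * qExp (q ^ (-2 : ℤ)) y := by
  have := qExp_sq_conj_quad hq.inv h1 (c := c) ?_ ?_
  · simpa only [inv_zpow', neg_neg] using this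
  · rw [qnum_inv, h2, inv_zpow']
  · rw [h3, inv_zpow']

theorem qExp_mul_quad (t : 𝕜) {y a b c a' b' c' : A} (h0 : a = a')
    (h1 : y * a + b = a' * y + b')
    (h2 : ∀ n, expCoeff t (n + 2) • (y ^ (n + 2) * a) + expCoeff t (n + 1) • (y ^ (n + 1) * b) +
      expCoeff t n • (y ^ n * c) = expCoeff t (n + 2) • (a' * y ^ (n + 2)) +
      expCoeff t (n + 1) • (b' * y ^ (n + 1)) + expCoeff t n • (c' * y ^ n))
    (ht : t ≠ 1) :
    qExp t y * (quad a b c : A⟦X⟧) = (quad a' b' c' : A⟦X⟧) * qExp t y := by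
  have hx (φ : A⟦X⟧) : X * φ = φ * X := (commute_X φ).eq.symm
  have hx2 (φ : A⟦X⟧) : X ^ 2 * φ = φ * X ^ 2 := (commute_X_pow φ 2).eq.symm
  have e1 : (t - 1) / (t - 1) = 1 := div_self (sub_ne_zero.mpr ht)
  have e0 : constantCoeff (qExp t y) = 1 := by
    rw [← coeff_zero_eq_constantCoeff_apply, coeff_qExp]
    simp [expCoeff]
  simp only [quad, Polynomial.coe_add, Polynomial.coe_mul, Polynomial.coe_C, Polynomial.coe_X,
    Polynomial.coe_pow, mul_add, add_mul, mul_assoc, hx, hx2]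
  simp only [← mul_assoc]
  ext n
  obtain _ | _ | n := n
  · simp [h0, e0, pow_two, ← mul_assoc]
  · simpa [coeff_succ_mul_X, coeff_zero_mul_X, pow_two, ← mul_assoc, coeff_mul_C, coeff_C_mul, e1,
      expCoeff] using h1
  · simpa [coeff_succ_mul_X, pow_two (X : A⟦X⟧), ← mul_assoc, coeff_mul_C, coeff_C_mul] using h2 n

theorem IsQuantumSl2.lift_k_inv (h : IsQuantumSl2 q e f k) :
    Lift q e f k 0 (↑k⁻¹ : A) (quad (↑k⁻¹ : A) ((q - q ^ 3) • (f * ↑k⁻¹)) 0)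
      (quad (k : A) ((q - q⁻¹) • e) 0) (quad (↑k⁻¹ : A) ((q - q⁻¹) • e) 0) 2 2 where
  wt := by simpa using hasWt_zpow q k (-1)
  deg_s := natDegree_quad_le _ _ _
  deg_p := natDegree_quad_le _ _ _
  shift := by simp
  conj_twist := by
    have h0 := h.generic.1
    have h1 := h.wt_e
    have h2 := h.wt_e.units_inv h0
    rw [HasWt] at h1
    rw [twist, tri]
    simp only [zpow_zero, Units.val_one, mul_one, zero_mul, Int.zero_ediv, one_smul]
    refine qExp_sq_conj_quad h.generic ?_ ?_ ?_
    · simp only [smul_mul_assoc, mul_smul_comm, mul_assoc, Units.mul_inv, ← mul_assoc _ e, h2,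
        mul_one, Units.inv_mul]
      match_scalars
      simp only [zpow_neg, zpow_two]
      field_simp
    · simp only [smul_mul_assoc, mul_smul_comm, mul_assoc, h1, smul_zero, smul_smul]
      match_scalars
      simp only [zpow_two]
      field_simp
      ring
    · simp
  conj_self := by
    have h0 := h.generic.1
    have h1 := h.wt_f
    have h2 := h.wt_f.units_inv h0
    rw [HasWt] at h1
    refine qExp_inv_sq_conj_quad h.generic ?_ ?_ ?_
    · simp only [smul_mul_assoc, mul_smul_comm, h2]
      match_scalars
      simp only [zpow_neg, zpow_two]
      field_simp
    · simp only [smul_mul_assoc, mul_smul_comm, mul_assoc, h2, smul_zero, smul_smul]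
      match_scalars
      simp only [zpow_neg, zpow_two]
      field_simp
      ring
    · simp
  link := by
    have h0 := h.generic.1
    rw [reflect_quad, reflect_quad]
    have key (n : ℕ) : expCoeff (q ^ (-2 : ℤ)) (n + 1) • (f ^ (n + 1) * ((q - q⁻¹) • e)) +
        expCoeff (q ^ (-2 : ℤ)) n • (f ^ n * (k : A)) =
        expCoeff (q ^ (-2 : ℤ)) (n + 1) • (((q - q⁻¹) • e) * f ^ (n + 1)) +
        expCoeff (q ^ (-2 : ℤ)) n • (↑k⁻¹ * f ^ n) := by
      have h2 := (h.wt_f.pow h0 n).units_inv h0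
      have h3 := expCoeff_inv_sq h.generic n
      rw [mul_smul_comm, smul_mul_assoc, h.e_mul_f_pow, h2]
      have hn := zpow_ne_zero (n : ℤ) h0
      have hd := h.generic.sub_inv_ne_zero
      rw [mul_neg, neg_neg, mul_two, zpow_add₀ h0, zpow_neg q (n : ℤ)]
      generalize expCoeff (q ^ (-2 : ℤ)) = c at *
      generalize q ^ (n : ℤ) = x at *
      have h4 : c n = x⁻¹ * (qnum q (n + 1) * c (n + 1)) := by rw [h3]; field_simp
      rw [h4]
      generalize q - q⁻¹ = d at *
      match_scalars
      all_goals
        field_simp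
        try ring
    refine qExp_mul_quad _ rfl ?_ (fun n => ?_) ?_
    · simp
    · simpa using key n
    · simpa using h.generic.inv_sq_pow_ne_one 0

end LiftGenerators

section LiftE

open Polynomial (reflect)

variable {𝕜 : Type*} [Field 𝕜] {A : Type*} [Ring A] [Algebra 𝕜 A]
  {q : 𝕜} {e f : A} {k : Aˣ}

theorem IsQuantumSl2.qExp_conj_e_mul_k_inv (h : IsQuantumSl2 q e f k) :
    qExp (q ^ (-2 : ℤ)) (q • f) * C (e * ↑k⁻¹) =
      (quad (e * ↑k⁻¹) (q • ((f * e - q ^ 2 • (e * f)) * ↑k⁻¹)) (-q ^ 5 • (f * ↑k⁻¹ * ↑k⁻¹)) :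
        A⟦X⟧) * qExp (q ^ (-2 : ℤ)) (q • f) := by
  have h0 := h.generic.1
  have h1 := h.wt_f
  have h2 := h.wt_f.units_inv h0
  have hlie : e * f = f * e + (q - q⁻¹)⁻¹ • ((k : A) - ↑k⁻¹) := by rw [← h.lie]; abel
  have h2' (x : A) : (↑k⁻¹ : A) * (f * x) = q ^ 2 • (f * (↑k⁻¹ * x)) := by
    rw [← mul_assoc, h2, smul_mul_assoc, mul_assoc, neg_neg]
    norm_cast
  have hlie' (x : A) : e * (f * x) = f * (e * x) + (q - q⁻¹)⁻¹ • ((k * x : A) - ↑k⁻¹ * x) := by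
    rw [← mul_assoc, hlie, add_mul, smul_mul_assoc, sub_mul, mul_assoc]
  have h2'' : (↑k⁻¹ : A) * f = q ^ 2 • (f * ↑k⁻¹) := by
    simpa using h2' 1
  rw [HasWt] at h1
  refine qExp_inv_sq_conj_quad h.generic ?_ ?_ ?_
  · simp only [smul_mul_assoc, mul_smul_comm, mul_assoc, h2, sub_mul]
    match_scalars
    · simp
    · simp only [zpow_neg, zpow_two]
      field_simp
  · simp only [smul_mul_assoc, mul_smul_comm, mul_assoc, h2'', hlie', hlie, h2', sub_mul, add_mul,
      mul_add, mul_sub, smul_add, smul_sub, Units.mul_inv, mul_one, one_mul]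
    have h3 := h.generic.sq_sub_one_ne_zero
    have h4 := h.generic.sub_inv_ne_zero
    match_scalars
    all_goals
      try simp only [zpow_neg, zpow_two, qnum]
      field_simp
      try ring
  · simp only [smul_mul_assoc, mul_smul_comm, mul_assoc, h2, h2']
    match_scalars
    simp only [show (4 : ℤ) = 2 + 2 from rfl, zpow_add₀ h0, zpow_two, neg_neg, zpow_neg]
    field_simp

theorem IsQuantumSl2.qExp_coeff_e_mul_k (h : IsQuantumSl2 q e f k) (n : ℕ) :
    expCoeff (q ^ (-2 : ℤ)) (n + 2) • (f ^ (n + 2) * (q ^ 3 • (e * ↑k))) +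
      expCoeff (q ^ (-2 : ℤ)) (n + 1) • (f ^ (n + 1) * (q • ((e * f - q ^ 2 • (f * e)) * ↑k))) +
      expCoeff (q ^ (-2 : ℤ)) n • (f ^ n * -(f * ↑k * ↑k)) =
      expCoeff (q ^ (-2 : ℤ)) (n + 2) • ((q ^ 3 • (e * ↑k)) * f ^ (n + 2)) := by
  have h0 := h.generic.1
  have h1 := h.wt_f.pow h0 (n + 2)
  have h2 := h.e_mul_f_pow (n + 1)
  have h3 := expCoeff_inv_sq h.generic n
  have h4 := expCoeff_inv_sq h.generic (n + 1)
  have h5 : (f ^ n * -(f * ↑k * ↑k) : A) = -(f ^ (n + 1) * ↑k * ↑k) := by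
    rw [mul_neg, pow_succ]
    simp only [mul_assoc]
  have h6 : e * f = f * e + (q - q⁻¹)⁻¹ • ((k : A) - ↑k⁻¹) := by rw [← h.lie]; abel
  rw [HasWt] at h1
  rw [h5, smul_mul_assoc, mul_assoc e, h1, mul_smul_comm, mul_smul_comm _ e, ← mul_assoc e,
    show n + 2 = n + 1 + 1 from rfl, h2, h6]
  rw [pow_succ f (n + 1)]
  generalize f ^ (n + 1) = y
  simp only [smul_mul_assoc, mul_smul_comm, mul_assoc, add_mul, mul_add, sub_mul, mul_sub,
    Units.inv_mul, mul_one, smul_add, smul_sub]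
  have hn := zpow_ne_zero (n : ℤ) h0
  have h7 := h.generic.sub_inv_ne_zero
  push_cast at h3 h4 ⊢
  simp only [mul_neg, neg_add, mul_two, zpow_add₀ h0, zpow_neg, zpow_one, zpow_two, add_assoc,
    one_add_one_eq_two] at h3 h4 ⊢
  generalize expCoeff (q * q)⁻¹ = c at *
  have h8 : c (n + 1) = (q ^ (n : ℤ))⁻¹ * q⁻¹ * (qnum q (n + 2) * c (n + 2)) := by
    rw [h4]
    field_simp
  have h9 : c n = (q ^ (n : ℤ))⁻¹ * (qnum q (n + 1) * c (n + 1)) := by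
    rw [h3]
    field_simp
  have h10 := h.generic.sq_sub_one_ne_zero
  rw [h9, h8]
  generalize c (n + 2) = z
  clear h9 h8 h4 h3 h1 h2 h5 h6
  simp only [qnum, neg_add, zpow_add₀ h0, zpow_neg, zpow_one, zpow_two]
  generalize q ^ (n : ℤ) = N at *
  match_scalars
  all_goals
    field_simp
    try ring

theorem IsQuantumSl2.lift_e_mul_k_inv (h : IsQuantumSl2 q e f k) :
    Lift q e f k 2 (e * ↑k⁻¹)
      (quad (e * ↑k⁻¹) (q • ((f * e - q ^ 2 • (e * f)) * ↑k⁻¹)) (-q ^ 5 • (f * ↑k⁻¹ * ↑k⁻¹)))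
      (quad (-(f * ↑k * ↑k)) (q • ((e * f - q ^ 2 • (f * e)) * ↑k)) (q ^ 3 • (e * ↑k)))
      (Polynomial.C (q ^ 3 • (e * ↑k))) 2 0 where
  wt := by simpa using h.wt_e.mul h.generic.1 (hasWt_zpow q k (-1))
  deg_s := natDegree_quad_le _ _ _
  deg_p := by simp
  shift := by simp
  conj_twist := by
    have h0 := h.generic.1
    have e1 : twist q k 2 (e * (↑k⁻¹ : A)) = q ^ 3 • (e * ↑k) := by
      rw [twist, show tri 2 = 3 from rfl, zpow_two k, Units.val_mul, mul_assoc,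
        Units.inv_mul_cancel_left]
      simp
    rw [e1]
    ext n
    have : Commute (e * (k : A)) ((e * ↑k) ^ n) := (Commute.refl _).pow_right n
    simp [coeff_mul_C, coeff_C_mul, smul_pow, this.eq, smul_comm (q ^ 3)]
  conj_self := h.qExp_conj_e_mul_k_inv
  link := by
    have h0 := h.generic.1
    have e1 : reflect 0 (Polynomial.C (q ^ 3 • (e * (k : A)))) =
        quad (q ^ 3 • (e * (k : A))) 0 0 := by
      rw [Polynomial.reflect_C]
      simp [quad]
    rw [reflect_quad, e1]
    refine qExp_mul_quad _ rfl ?_ (fun n => ?_) ?_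
    · have h1 := h.wt_f
      rw [HasWt] at h1
      rw [smul_mul_assoc, mul_assoc e, h1]
      simp only [smul_mul_assoc, mul_smul_comm, mul_assoc, sub_mul, smul_sub]
      match_scalars
      · ring
      · simp only [zpow_neg, zpow_two]
        field_simp
    · simpa using h.qExp_coeff_e_mul_k n
    · simpa using h.generic.inv_sq_pow_ne_one 0

end LiftE

section Reflection

variable {𝕜 : Type*} [Field 𝕜] {A : Type*} [Ring A] [Algebra 𝕜 A]

/-- The endomorphism `T` acts on the quantum `sl₂`-triple `e, f, k` as Lusztig's reflection. -/
structure IsReflection (q : 𝕜) (e f : A) (k : Aˣ) (T : A →ₐ[𝕜] A) : Prop where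
  sl2 : IsQuantumSl2 q e f k
  map_e : T e = -(f * k)
  map_f : T f = -(↑k⁻¹ * e)
  map_k : T k = ↑k⁻¹

/-- `x` has weight `w`, and the image of its conjugate by a `q`-exponential under `T` is the
conjugate of `x` twisted by `T`. -/
def Liftable (q : 𝕜) (e f : A) (k : Aˣ) (T : A →ₐ[𝕜] A) (w : ℤ) (x : A) : Prop :=
  ∃ r p N M, Lift q e f k w x r (r.map (T : A →+* A)) p N M

/-- `x` has weight `w` and becomes liftable after multiplication by a negative power of `k`. -/
def LocallyLiftable (q : 𝕜) (e f : A) (k : Aˣ) (T : A →ₐ[𝕜] A) (w : ℤ) (x : A) : Prop :=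
  HasWt q k w x ∧ ∃ N : ℕ, Liftable q e f k T w (↑(k ^ (-N : ℤ)) * x)

variable {q : 𝕜} {e f x y v : A} {k : Aˣ} {T : A →ₐ[𝕜] A} {w w' : ℤ} {m : ℕ}

namespace Liftable

theorem of_lift {r s p : Polynomial A} {N M : ℕ} (h : Lift q e f k w x r s p N M)
    (hs : r.map (T : A →+* A) = s) : Liftable q e f k T w x :=
  ⟨r, p, N, M, hs ▸ h⟩

theorem mul (hq : q ≠ 0) (hx : Liftable q e f k T w x) (hy : Liftable q e f k T w' y) :
    Liftable q e f k T (w + w') (x * y) := by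
  obtain ⟨r, p, N, M, h⟩ := hx
  obtain ⟨r', p', N', M', h'⟩ := hy
  refine ⟨r * r', p * p', N + N', M + M', ?_⟩
  rw [Polynomial.map_mul]
  exact h.mul hq h'

theorem add (hq : q ≠ 0) (hx : Liftable q e f k T w x) (hy : Liftable q e f k T w y) :
    Liftable q e f k T w (x + y) := by
  obtain ⟨r, p, N, M, h⟩ := hx
  obtain ⟨r', p', N', M', h'⟩ := hy
  refine ⟨r + r', p + p', N + N', M + N', ?_⟩
  rw [Polynomial.map_add]
  exact h.add hq h'

theorem scalar (q : 𝕜) (e f : A) (k : Aˣ) (T : A →ₐ[𝕜] A) (c : 𝕜) :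
    Liftable q e f k T 0 (algebraMap 𝕜 A c) :=
  of_lift (Lift.scalar q e f k c) (by simp)

theorem smul (hq : q ≠ 0) (c : 𝕜) (hx : Liftable q e f k T w x) :
    Liftable q e f k T w (c • x) := by
  simpa [Algebra.smul_def] using (scalar q e f k T c).mul hq hx

end Liftable

namespace IsReflection

variable (h : IsReflection q e f k T)
include h

theorem map_k_inv : T (↑k⁻¹ : A) = k := by
  have h1 : T (k : A) * T (↑k⁻¹ : A) = 1 := by rw [← map_mul, Units.mul_inv, map_one]
  rw [h.map_k, Units.inv_mul_eq_iff_eq_mul, mul_one] at h1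
  exact h1

theorem map_k_zpow (z : ℤ) : T (↑(k ^ z) : A) = ↑(k ^ (-z)) := by
  induction z with
  | zero => simp
  | succ n ih => rw [zpow_add_one, Units.val_mul, map_mul, ih, h.map_k, ← Units.val_mul, neg_add,
      ← sub_eq_add_neg, zpow_sub_one]
  | pred n ih => rw [zpow_sub_one, Units.val_mul, map_mul, ih, h.map_k_inv, ← Units.val_mul,
      neg_sub, sub_neg_eq_add, neg_neg, add_comm, zpow_add_one]

theorem liftable_k_inv : Liftable q e f k T 0 (↑k⁻¹ : A) := by
  have h0 := h.sl2.generic.1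
  refine .of_lift h.sl2.lift_k_inv ?_
  have h1 := h.sl2.wt_e.units_inv h0
  simp only [map_quad, RingHom.coe_coe, map_smul, map_mul, h.map_k_inv, h.map_f, map_zero]
  congr 1
  rw [neg_mul, h1, smul_mul_assoc, mul_assoc, Units.inv_mul, mul_one]
  match_scalars
  simp only [zpow_neg, zpow_two]
  field_simp
  ring

theorem liftable_k_zpow (N : ℕ) : Liftable q e f k T 0 (↑(k ^ (-N : ℤ)) : A) := by
  induction N with
  | zero => simpa using Liftable.scalar q e f k T 1
  | succ N ih =>
    have := ih.mul h.sl2.generic.1 h.liftable_k_inv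
    rw [← Units.val_mul, ← zpow_sub_one, add_zero] at this
    convert this using 4
    push_cast
    ring

theorem liftable_e_mul_k_inv : Liftable q e f k T 2 (e * ↑k⁻¹) := by
  have h0 := h.sl2.generic.1
  refine .of_lift h.sl2.lift_e_mul_k_inv ?_
  have h1 := h.sl2.wt_e.units_inv h0
  have h2 := h.sl2.wt_f
  rw [HasWt] at h2
  have h3 : (↑k⁻¹ : A) * e * (f * k) = e * f := by
    rw [h1, smul_mul_assoc, mul_assoc, ← mul_assoc _ f, h.sl2.wt_f.units_inv h0, smul_mul_assoc,
      mul_smul_comm, smul_smul, mul_assoc f, Units.inv_mul, mul_one, ← zpow_add₀ h0, neg_neg,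
      neg_add_cancel, zpow_zero, one_smul]
  have h4 : f * k * (↑k⁻¹ * e) = f * e := by rw [mul_assoc, Units.mul_inv_cancel_left]
  simp only [map_quad, RingHom.coe_coe, map_smul, map_mul, h.map_k_inv, h.map_f, h.map_e, map_sub,
    neg_mul_neg, h3, h4]
  congr 1
  · simp
  · rw [neg_mul, neg_mul, h1, smul_mul_assoc, smul_mul_assoc, mul_assoc e, Units.inv_mul, mul_one]
    match_scalars
    simp only [zpow_neg, zpow_two]
    field_simp

theorem liftable_lowest (hv : HasWt q k (-m) v) (hf : f * v = v * f)
    (h0 : adj q e m v (m + 1) = 0) (hT : T v = adjTop q e m v) : Liftable q e f k T (-m) v := by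
  exact .of_lift (h.sl2.lift_lowest hv hf h0) (by simp [hT])

end IsReflection

theorem Liftable.raise (h : IsReflection q e f k T) {N : ℕ}
    (hN : Liftable q e f k T w (↑(k ^ (-N : ℤ)) * x)) (j : ℕ) :
    Liftable q e f k T w (↑(k ^ (-(N + j : ℕ) : ℤ)) * x) := by
  have := (h.liftable_k_zpow j).mul h.sl2.generic.1 hN
  rw [← mul_assoc, ← Units.val_mul, ← zpow_add, zero_add] at this
  convert this using 4
  push_cast
  ring

theorem LocallyLiftable.of_liftable (hx : Liftable q e f k T w x) : LocallyLiftable q e f k T w x :=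
  ⟨hx.choose_spec.choose_spec.choose_spec.choose_spec.wt, 0, by simpa using hx⟩

namespace LocallyLiftable

variable (h : IsReflection q e f k T)
include h

theorem mul (hx : LocallyLiftable q e f k T w x) (hy : LocallyLiftable q e f k T w' y) :
    LocallyLiftable q e f k T (w + w') (x * y) := by
  have hq := h.sl2.generic.1
  obtain ⟨hx, N, hN⟩ := hx
  obtain ⟨hy, N', hN'⟩ := hy
  refine ⟨hx.mul hq hy, N + N', ?_⟩
  have := (hN.mul hq hN').smul hq (q ^ (w * -N'))
  convert this using 1
  rw [mul_assoc, ← mul_smul_comm, ← mul_assoc x, ← smul_mul_assoc, ← hx.units_zpow hq]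
  simp only [← mul_assoc, ← Units.val_mul, ← zpow_add]
  push_cast
  rw [neg_add]

theorem add (hx : LocallyLiftable q e f k T w x) (hy : LocallyLiftable q e f k T w y) :
    LocallyLiftable q e f k T w (x + y) := by
  have hq := h.sl2.generic.1
  obtain ⟨hx, N, hN⟩ := hx
  obtain ⟨hy, N', hN'⟩ := hy
  refine ⟨hx.add hy, N + N', ?_⟩
  rw [mul_add]
  have := Liftable.raise h hN' N
  rw [add_comm N' N] at this
  exact (Liftable.raise h hN N').add hq this

theorem smul (c : 𝕜) (hx : LocallyLiftable q e f k T w x) :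
    LocallyLiftable q e f k T w (c • x) := by
  obtain ⟨hx, N, hN⟩ := hx
  exact ⟨hx.smul c, N, by simpa using hN.smul h.sl2.generic.1 c⟩

theorem self : LocallyLiftable q e f k T 2 e := by
  refine ⟨h.sl2.wt_e, 1, ?_⟩
  have h1 := h.sl2.wt_e.units_inv h.sl2.generic.1
  have := h.liftable_e_mul_k_inv.smul h.sl2.generic.1 (q ^ (-2 : ℤ))
  rw [← h1] at this
  simpa using this

theorem map_eq_adjTop (hx : LocallyLiftable q e f k T w v) (hv : HasWt q k (-m) v)
    (hf : f * v = v * f) (h0 : adj q e m v (m + 1) = 0) : T v = adjTop q e m v := by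
  have hq := h.sl2.generic.1
  obtain rfl | hv0 := eq_or_ne v 0
  · have : adj q e m (0 : A) m = 0 := adj_eq_zero_of_le (adj_zero q e m 0) (Nat.zero_le _)
    rw [adjTop, this, map_zero, smul_zero]
  obtain rfl : w = -m := by
    have h1 := hx.1.symm.trans hv
    by_contra hne
    have h2 : v * (k : A) = 0 := by
      have h3 : (q ^ w - q ^ (-m : ℤ)) • (v * (k : A)) = 0 := by rw [sub_smul, h1, sub_self]
      refine (smul_eq_zero_iff_right ?_).mp h3
      intro h4
      refine h.sl2.generic.zpow_ne_one (sub_ne_zero.mpr hne) ?_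
      rw [zpow_sub₀ hq, sub_eq_zero.mp h4, div_self (zpow_ne_zero _ hq)]
    exact hv0 (by simpa using congrArg (· * (↑k⁻¹ : A)) h2)
  obtain ⟨_, N, r, p, M, M', hr⟩ := hx
  obtain ⟨r', p', L, L', hr'⟩ := h.liftable_k_zpow N
  have h1 := hr'.mul hq (h.sl2.lift_lowest hv hf h0)
  rw [zero_add] at h1
  obtain ⟨e1, e2⟩ := hr.unique hq h1
  rw [e1, Polynomial.map_mul] at e2
  have e3 := congrArg (fun g => g.coeff 0) e2
  simp only [Polynomial.mul_coeff_zero, Polynomial.coeff_map, Polynomial.coeff_C_zero,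
    hr'.coeff_zero, Polynomial.map_C, RingHom.coe_coe, h.map_k_zpow] at e3
  exact (Units.mul_right_inj _).mp e3

end LocallyLiftable

end Reflection

section RankTwo

variable {𝕜 : Type*} [Field 𝕜] {A : Type*} [Ring A] [Algebra 𝕜 A] {I : Type*}

/-- The relations between the generators `E i`, `F i`, `k i` of a quantum group and Lusztig's
operators `T i` which involve the Serre relations only for the `E i`. -/
structure LusztigSystem (q : I → 𝕜) (a : I → I → ℤ) (E F : I → A) (k : I → Aˣ)
    (T : I → A →ₐ[𝕜] A) : Prop where
  reflection : ∀ i, IsReflection (q i) (E i) (F i) (k i) (T i)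
  wt : ∀ i j, HasWt (q i) (k i) (a i j) (E j)
  nonpos : ∀ i j, i ≠ j → a i j ≤ 0
  comm : ∀ i j, i ≠ j → F i * E j = E j * F i
  serre : ∀ i j, i ≠ j → adj (q i) (E i) (-a i j).toNat (E j) ((-a i j).toNat + 1) = 0
  map_E : ∀ i j, i ≠ j → T i (E j) = adjTop (q i) (E i) (-a i j).toNat (E j)

theorem map_adjTop {B : Type*} [Ring B] [Algebra 𝕜 B] (φ : A →ₐ[𝕜] B) (q : 𝕜) (e : A) (m : ℕ)
    (v : A) : φ (adjTop q e m v) = adjTop q (φ e) m (φ v) := by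
  rw [adjTop, map_smul, map_adj, adjTop]

/-- `x` is a homogeneous element to which the rank one argument applies. -/
def HomLiftable (q : 𝕜) (e f : A) (k : Aˣ) (T : A →ₐ[𝕜] A) (x : A) : Prop :=
  ∃ w, LocallyLiftable q e f k T w x

namespace HomLiftable

variable {q : 𝕜} {e f x y : A} {k : Aˣ} {T : A →ₐ[𝕜] A} (h : IsReflection q e f k T)
include h

theorem smul (c : 𝕜) (hx : HomLiftable q e f k T x) : HomLiftable q e f k T (c • x) := by
  obtain ⟨w, hx⟩ := hx
  exact ⟨w, hx.smul h c⟩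

theorem neg (hx : HomLiftable q e f k T x) : HomLiftable q e f k T (-x) := by
  simpa using hx.smul h (-1)

theorem sub_smul_mul (hx : HomLiftable q e f k T x) (hy : HomLiftable q e f k T y) (c : 𝕜) :
    HomLiftable q e f k T (x * y - c • (y * x)) := by
  obtain ⟨w, hx⟩ := hx
  obtain ⟨w', hy⟩ := hy
  refine ⟨w + w', ?_⟩
  have h1 := (hy.mul h hx).smul h (-c)
  rw [add_comm w' w] at h1
  simpa [sub_eq_add_neg] using (hx.mul h hy).add h h1

theorem adj (hx : HomLiftable q e f k T x) (hy : HomLiftable q e f k T y) (p : 𝕜) (m n : ℕ) :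
    HomLiftable q e f k T (adj p x m y n) := by
  induction n with
  | zero => exact hy
  | succ n ih => exact (hx.sub_smul_mul h ih _).smul h _

theorem adjTop (hx : HomLiftable q e f k T x) (hy : HomLiftable q e f k T y) (p : 𝕜) (m : ℕ) :
    HomLiftable q e f k T (adjTop p x m y) :=
  (hx.adj h hy p m m).smul h _

end HomLiftable

namespace LusztigSystem

variable {q : I → 𝕜} {a : I → I → ℤ} {E F : I → A} {k : I → Aˣ} {T : I → A →ₐ[𝕜] A}
  {i j t l : I} {m : ℕ} (h : LusztigSystem q a E F k T)

/-- The elements to which the rank one argument for the index `t` applies. -/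
abbrev Good (_ : LusztigSystem q a E F k T) (t : I) (x : A) : Prop :=
  HomLiftable (q t) (E t) (F t) (k t) (T t) x

include h

theorem wt' (hij : i ≠ j) : HasWt (q i) (k i) (-(-a i j).toNat) (E j) := by
  have h1 := h.nonpos i j hij
  have h2 := h.wt i j
  rwa [show -((-a i j).toNat : ℤ) = a i j by omega]

theorem good_E (t l : I) : h.Good t (E l) := by
  obtain rfl | htl := eq_or_ne t l
  · exact ⟨2, .self (h.reflection t)⟩
  · exact ⟨_, .of_liftable ((h.reflection t).liftable_lowest (h.wt' htl) (h.comm t l htl)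
      (h.serre t l htl) (h.map_E t l htl))⟩

theorem good_map_T (ψ : A →ₐ[𝕜] A) (hjl : j ≠ l) (hj : h.Good t (ψ (E j)))
    (hl : h.Good t (ψ (E l))) : h.Good t (ψ (T j (E l))) := by
  rw [h.map_E j l hjl, map_adjTop]
  exact hj.adjTop (h.reflection t) hl _ _

theorem good_T (t : I) (hjl : j ≠ l) : h.Good t (T j (E l)) :=
  h.good_map_T (AlgHom.id 𝕜 A) hjl (h.good_E t j) (h.good_E t l)

theorem map_T_E_of_good (φ : A →ₐ[𝕜] A) (hE : φ (E i) = E t) (hF : φ (F i) = F t)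
    (hk : φ (k i) = k t) (hq : q i = q t) (hil : i ≠ l) (hl : h.Good t (φ (E l))) :
    φ (T i (E l)) = T t (φ (E l)) := by
  obtain ⟨w, hl⟩ := hl
  have h1 := congrArg φ (h.wt' hil)
  have h2 := congrArg φ (h.comm i l hil)
  have h3 := congrArg φ (h.serre i l hil)
  rw [map_adj, map_zero, hE, hq] at h3
  simp only [map_mul, map_smul, hF, hk, hq] at h1 h2
  rw [h.map_E i l hil, map_adjTop, hE, hq]
  exact (hl.map_eq_adjTop (h.reflection t) h1 h2 h3).symm

theorem T_of_zero (hij : i ≠ j) (h0 : a i j = 0) : T i (E j) = E j := by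
  simp [h.map_E i j hij, adjTop, h0]

theorem T_of_neg_one (hij : i ≠ j) (h1 : a i j = -1) :
    T i (E j) = (q i)⁻¹ • (E j * E i) - E i * E j := by
  simp [h.map_E i j hij, adjTop, h1, adj, (h.reflection i).sl2.generic.qnum_one]

/-- If `a j i = -1` then `T j` maps the first term of the string of `E j` to `-E i`. -/
theorem T_string_one (hij : i ≠ j) (h1 : a j i = -1) :
    T j (E i * E j - (q j)⁻¹ • (E j * E i)) = -E i := by
  have hr := h.reflection j
  have hg := hr.sl2.generic
  have hv := h.wt' hij.symm
  rw [h1] at hv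
  have e1 := hr.sl2.f_mul_adj_succ (m := 1) hv (h.comm j i hij.symm) 0
  have e2 := hr.sl2.wt_adj (m := 1) hv 1
  have e3 : T j (E i) = -adj (q j) (E j) 1 (E i) 1 := by
    simp [h.map_E j i hij.symm, adjTop, h1]
  generalize adj (q j) (E j) 1 (E i) 1 = w at *
  rw [HasWt] at e2
  rw [map_sub, map_smul, map_mul, map_mul, hr.map_e, e3, neg_mul_neg, neg_mul_neg, mul_assoc (F j),
    e2, mul_smul_comm, ← mul_assoc (F j), e1, add_mul, smul_smul]
  simp [hg.qnum_one, hg.1, ← mul_assoc]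

section Words

variable (hij : i ≠ j) (hji : a j i = -1) (hm : a i j = -m) (hq : q i ^ m = q j)
include hij hm

omit hij in
theorem wt_adj_E (n : ℕ) :
    HasWt (q i) (k i) (2 * n - m) (adj (q i) (E i) m (E j) n) := by
  have hv := h.wt i j
  rw [hm] at hv
  exact (h.reflection i).sl2.wt_adj hv n

theorem F_mul_adj_E (n : ℕ) : F i * adj (q i) (E i) m (E j) (n + 1) =
    adj (q i) (E i) m (E j) (n + 1) * F i +
      qnum (q i) (m - n) • (adj (q i) (E i) m (E j) n * ↑(k i)⁻¹) := by
  have hv := h.wt i j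
  rw [hm] at hv
  exact (h.reflection i).sl2.f_mul_adj_succ hv (h.comm i j hij) n

theorem T_E : T i (E j) = (-1 : 𝕜) ^ m • adj (q i) (E i) m (E j) m := by
  rw [h.map_E i j hij, adjTop, hm, neg_neg, Int.toNat_natCast]

theorem F_mul_k_mul_adj_E (n : ℕ) :
    q i ^ (m - 2 * (n + 1) : ℤ) • (F i * k i * adj (q i) (E i) m (E j) (n + 1)) =
      adj (q i) (E i) m (E j) (n + 1) * (F i * k i) +
        qnum (q i) (m - n) • adj (q i) (E i) m (E j) n := by
  have h0 := (h.reflection i).sl2.generic.1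
  have h1 := h.wt_adj_E hm (n + 1)
  rw [HasWt] at h1
  rw [mul_assoc, h1, mul_smul_comm, smul_smul, ← zpow_add₀ h0, ← mul_assoc, h.F_mul_adj_E hij hm,
    add_mul, smul_mul_assoc, Units.inv_mul_cancel_right, mul_assoc]
  push_cast
  rw [show (m - 2 * (n + 1) + (2 * (n + 1) - m) : ℤ) = 0 by ring, zpow_zero, one_smul]

include hji hq

omit hm in
theorem T_string : T j (adj (q i) (E i) m (E j) 1) = -E i := by
  have h1 := h.T_string_one hij hji
  rw [← hq] at h1
  simpa [adj, (h.reflection i).sl2.generic.qnum_one] using h1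

omit hm in
theorem T_T_string : T i (T j (adj (q i) (E i) m (E j) 1)) = F i * k i := by
  rw [h.T_string hij hji hq, map_neg, (h.reflection i).map_e, neg_neg]

theorem T_T_E {n : ℕ} (hn : m = n + 1) :
    T i (T j (E i)) = (-1 : 𝕜) ^ n • adj (q i) (E i) m (E j) n := by
  have hg := (h.reflection i).sl2.generic
  have h1 := h.F_mul_k_mul_adj_E hij hm n
  rw [← hn, show (m - n : ℤ) = 1 by omega, show (m - 2 * (n + 1) : ℤ) = -m by omega, hg.qnum_one,
    one_smul, zpow_neg, zpow_natCast, hq] at h1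
  rw [h.T_of_neg_one hij.symm hji, map_sub, map_smul, map_mul, map_mul, h.T_E hij hm,
    (h.reflection i).map_e, neg_mul, smul_neg, mul_smul_comm, smul_comm, h1, hn, pow_succ]
  simp only [smul_mul_assoc, mul_neg]
  module

end Words

theorem T_T_E_of_one (hij : i ≠ j) (hji : a j i = -1) (hm : a i j = -1) (hq : q i = q j) :
    T i (T j (E i)) = E j := by
  simpa using h.T_T_E (m := 1) (n := 0) hij hji (by simpa using hm) (by simpa using hq) rfl

section Two

variable (hij : i ≠ j) (hji : a j i = -1) (hm : a i j = -(2 : ℕ)) (hq : q i ^ 2 = q j)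
include hij hji hm hq

theorem T_T_E_of_two : T i (T j (E i)) = -adj (q i) (E i) 2 (E j) 1 := by
  simpa using h.T_T_E hij hji hm hq rfl

theorem T_T_T_E_of_two : T j (T i (T j (E i))) = E i := by
  rw [h.T_T_E_of_two hij hji hm hq, map_neg, h.T_string hij hji hq, neg_neg]

theorem T_T_T_E_of_two' : T i (T j (T i (E j))) = E j := by
  have hg := (h.reflection i).sl2.generic
  have h1 := congrArg (fun x => T i (T j x)) (qnum_smul_adj_succ hg (E i) 2 (E j) 1)
  have h2 := h.F_mul_k_mul_adj_E hij hm 0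
  simp only [map_sub, map_smul, map_mul, h.T_T_string hij hji hq,
    h.T_T_E_of_two hij hji hm hq] at h1
  rw [h.T_E hij hm]
  have h3 := hg.qnum_ne_zero (z := 2) (by norm_num)
  norm_num at h1 h2 ⊢
  rw [h2, neg_add_cancel_left] at h1
  exact smul_right_injective A h3 h1

end Two

section Three

variable (hij : i ≠ j) (hji : a j i = -1) (hm : a i j = -(3 : ℕ)) (hq : q i ^ 3 = q j)
include hij hji hm hq

theorem T_T_E_of_three : T i (T j (E i)) = adj (q i) (E i) 3 (E j) 2 := by
  simpa using h.T_T_E hij hji hm hq rfl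

theorem T_T_string_two : T i (T j (adj (q i) (E i) 3 (E j) 2)) = -adj (q i) (E i) 3 (E j) 1 := by
  have hg := (h.reflection i).sl2.generic
  have h1 := congrArg (fun x => T i (T j x)) (qnum_smul_adj_succ hg (E i) 3 (E j) 1)
  have h2 := h.F_mul_k_mul_adj_E hij hm 1
  simp only [map_sub, map_smul, map_mul, h.T_T_string hij hji hq,
    h.T_T_E_of_three hij hji hm hq] at h1
  have h3 := hg.qnum_ne_zero (z := 2) (by norm_num)
  norm_num at h1 h2 ⊢
  rw [h2, sub_add_cancel_left, ← smul_neg] at h1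
  exact smul_right_injective A h3 h1

theorem T_T_T_T_T_E_of_three : T j (T i (T j (T i (T j (E i))))) = E i := by
  rw [h.T_T_E_of_three hij hji hm hq, h.T_T_string_two hij hji hm hq, map_neg,
    h.T_string hij hji hq, neg_neg]

theorem T_T_string_three : qnum (q i) 3 • T i (T j (adj (q i) (E i) 3 (E j) 3)) =
    q i • (adj (q i) (E i) 3 (E j) 1 * adj (q i) (E i) 3 (E j) 2) -
      adj (q i) (E i) 3 (E j) 2 * adj (q i) (E i) 3 (E j) 1 := by
  have hg := (h.reflection i).sl2.generic
  have h1 := congrArg (fun x => T i (T j x)) (qnum_smul_adj_succ hg (E i) 3 (E j) 2)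
  simp only [map_sub, map_smul, map_mul, h.T_T_string_two hij hji hm hq,
    h.T_T_E_of_three hij hji hm hq] at h1
  norm_num at h1
  rw [h1]
  abel

theorem T_T_T_T_T_E_of_three' : T i (T j (T i (T j (T i (E j))))) = E j := by
  have hg := (h.reflection i).sl2.generic
  have h1 := congrArg (fun x => T i (T j x)) (h.T_T_string_three hij hji hm hq)
  have h2 := h.F_mul_k_mul_adj_E hij hm 0
  simp only [map_sub, map_smul, map_mul, h.T_T_string hij hji hq,
    h.T_T_string_two hij hji hm hq] at h1
  rw [h.T_E hij hm]
  have h3 := hg.qnum_ne_zero (z := 3) (by norm_num)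
  norm_num at h1 h2 ⊢
  rw [h2] at h1
  refine smul_right_injective A h3 ?_
  simp only [smul_neg, h1]
  abel

end Three

end LusztigSystem

end RankTwo

section Braid

variable {𝕜 : Type*} [Field 𝕜] {A : Type*} [Ring A] [Algebra 𝕜 A] {I : Type*}

namespace LusztigSystem

variable {q : I → 𝕜} {a : I → I → ℤ} {E F : I → A} {k : I → Aˣ} {T : I → A →ₐ[𝕜] A}
  {i j t l : I} {m : ℕ} (h : LusztigSystem q a E F k T)
include h

theorem map_T_E_self (φ : A →ₐ[𝕜] A) (hF : φ (F i) = F t) (hk : φ (k i) = k t) :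
    φ (T i (E i)) = T t (E t) := by
  rw [(h.reflection i).map_e, (h.reflection t).map_e, map_neg, map_mul, hF, hk]

/-- The successive terms of a string remain good after applying a homomorphism. -/
theorem good_map_adj_succ (ψ : A →ₐ[𝕜] A) {p : 𝕜} {e v : A} {n : ℕ} (he : h.Good t (ψ e))
    (hv : h.Good t (ψ (adj p e m v n))) : h.Good t (ψ (adj p e m v (n + 1))) := by
  rw [adj, map_smul, map_sub, map_smul, map_mul, map_mul]
  exact (he.sub_smul_mul (h.reflection t) hv _).smul (h.reflection t) _

theorem braid_E_of_zero (hij : i ≠ j) (haij : a i j = 0) (haji : a j i = 0)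
    (hFi : T j (F i) = F i) (hFj : T i (F j) = F j) (hki : T j (k i) = k i)
    (hkj : T i (k j) = k j) (l : I) : T j (T i (E l)) = T i (T j (E l)) := by
  obtain rfl | hil := eq_or_ne i l
  · rw [h.map_T_E_self (T j) hFi hki, h.T_of_zero hij.symm haji]
  obtain rfl | hjl := eq_or_ne j l
  · rw [h.map_T_E_self (T i) hFj hkj, h.T_of_zero hij haij]
  refine h.map_T_E_of_good (T j) (h.T_of_zero hij.symm haji) hFi hki rfl hil ?_
  exact h.good_T i hjl

theorem braid_E_of_one (hij : i ≠ j) (haij : a i j = -1) (haji : a j i = -1) (hq : q i = q j)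
    (hFi : T i (T j (F i)) = F j) (hFj : T j (T i (F j)) = F i) (hki : T i (T j (k i)) = k j)
    (hkj : T j (T i (k j)) = k i) (l : I) :
    T i (T j (T i (E l))) = T j (T i (T j (E l))) := by
  have hEi := h.T_T_E_of_one hij haji haij hq
  have hEj := h.T_T_E_of_one hij.symm haij haji hq.symm
  obtain rfl | hil := eq_or_ne i l
  · rw [hEi]
    exact h.map_T_E_self ((T i).comp (T j)) hFi hki
  obtain rfl | hjl := eq_or_ne j l
  · rw [hEj]
    exact (h.map_T_E_self ((T j).comp (T i)) hFj hkj).symm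
  refine h.map_T_E_of_good ((T i).comp (T j)) hEi hFi hki hq hil ?_
  exact h.good_map_T (T i) hjl (h.good_T j hij) (h.good_T j hil)

theorem braid_E_of_two (hij : i ≠ j) (haij : a i j = -(2 : ℕ)) (haji : a j i = -1)
    (hq : q i ^ 2 = q j) (hFi : T j (T i (T j (F i))) = F i) (hFj : T i (T j (T i (F j))) = F j)
    (hki : T j (T i (T j (k i))) = k i) (hkj : T i (T j (T i (k j))) = k j) (l : I) :
    T j (T i (T j (T i (E l)))) = T i (T j (T i (T j (E l)))) := by
  have hEi := h.T_T_T_E_of_two hij haji haij hq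
  obtain rfl | hil := eq_or_ne i l
  · rw [hEi]
    exact h.map_T_E_self ((T j).comp ((T i).comp (T j))) hFi hki
  obtain rfl | hjl := eq_or_ne j l
  · rw [h.T_T_T_E_of_two' hij haji haij hq]
    exact (h.map_T_E_self ((T i).comp ((T j).comp (T i))) hFj hkj).symm
  refine h.map_T_E_of_good ((T j).comp ((T i).comp (T j))) hEi hFi hki rfl hil ?_
  have g1 := h.good_T i (j := j) (l := i) hij.symm
  have g2 : h.Good i (T j (T i (E j))) := by
    rw [h.T_E hij haij, map_smul]
    refine HomLiftable.smul (h.reflection i) _ (h.good_map_adj_succ (T j) g1 ?_)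
    rw [h.T_string hij haji hq]
    exact (h.good_E i i).neg (h.reflection i)
  exact h.good_map_T ((T j).comp (T i)) hjl g2 (h.good_map_T (T j) hil g1 (h.good_T i hjl))

theorem braid_E_of_three (hij : i ≠ j) (haij : a i j = -(3 : ℕ)) (haji : a j i = -1)
    (hq : q i ^ 3 = q j) (hFi : T j (T i (T j (T i (T j (F i))))) = F i)
    (hFj : T i (T j (T i (T j (T i (F j))))) = F j)
    (hki : T j (T i (T j (T i (T j (k i))))) = k i)
    (hkj : T i (T j (T i (T j (T i (k j))))) = k j) (l : I) :
    T j (T i (T j (T i (T j (T i (E l)))))) = T i (T j (T i (T j (T i (T j (E l)))))) := by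
  have hEi := h.T_T_T_T_T_E_of_three hij haji haij hq
  obtain rfl | hil := eq_or_ne i l
  · rw [hEi]
    exact h.map_T_E_self ((T j).comp ((T i).comp ((T j).comp ((T i).comp (T j))))) hFi hki
  obtain rfl | hjl := eq_or_ne j l
  · rw [h.T_T_T_T_T_E_of_three' hij haji haij hq]
    exact (h.map_T_E_self ((T i).comp ((T j).comp ((T i).comp ((T j).comp (T i))))) hFj hkj).symm
  refine h.map_T_E_of_good ((T j).comp ((T i).comp ((T j).comp ((T i).comp (T j))))) hEi hFi hki
    rfl hil ?_
  have hr := h.reflection i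
  have g1 := h.good_T i (j := j) (l := i) hij.symm
  have s1 : h.Good i (T j (adj (q i) (E i) 3 (E j) 1)) := by
    rw [h.T_string hij haji hq]
    exact (h.good_E i i).neg hr
  have s2 := h.good_map_adj_succ (T j) g1 s1
  have g2 : h.Good i (T j (T i (E j))) := by
    rw [h.T_E hij haij, map_smul]
    exact HomLiftable.smul hr _ (h.good_map_adj_succ (T j) g1 s2)
  have g3 : h.Good i (T j (T i (T j (E i)))) := by
    rwa [h.T_T_E_of_three hij haji haij hq]
  have g4 : h.Good i (T j (T i (T j (T i (E j))))) := by
    have h3 := hr.sl2.generic.qnum_ne_zero (z := 3) (by norm_num)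
    have h4 := congrArg (fun x => (qnum (q i) 3)⁻¹ • T j x) (h.T_T_string_three hij haji haij hq)
    simp only [map_smul, smul_smul, inv_mul_cancel₀ h3, one_smul, map_sub, map_mul] at h4
    rw [h.T_E hij haij, map_smul, map_smul, map_smul, h4, ← neg_sub]
    exact HomLiftable.smul hr _ (HomLiftable.smul hr _ ((s2.sub_smul_mul hr s1 _).neg hr))
  refine h.good_map_T ((T j).comp ((T i).comp ((T j).comp (T i)))) hjl g4 ?_
  refine h.good_map_T ((T j).comp ((T i).comp (T j))) hil g3 ?_
  refine h.good_map_T ((T j).comp (T i)) hjl g2 ?_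
  exact h.good_map_T (T j) hil g1 (h.good_T i hjl)

end LusztigSystem

/-- Inverse of a unit, viewed in the opposite ring. -/
def opInv (k : Aˣ) : Aᵐᵒᵖˣ :=
  ⟨.op ↑k⁻¹, .op ↑k, by simp [← MulOpposite.op_mul], by simp [← MulOpposite.op_mul]⟩

/-- A `LusztigSystem` which also satisfies the Serre relations for the `F i`, together with the
action of the operators on the torus. -/
structure FullLusztigSystem (q : I → 𝕜) (a : I → I → ℤ) (E F : I → A) (k : I → Aˣ)
    (T : I → A →ₐ[𝕜] A) : Prop where
  sys : LusztigSystem q a E F k T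
  opSys : LusztigSystem (fun i => (q i)⁻¹) a (fun i => .op (F i)) (fun i => .op (E i))
    (fun i => opInv (k i)) (fun i => AlgHom.op (T i))
  diag : ∀ i, a i i = 2
  comm_k : ∀ i j, k i * k j = k j * k i
  map_k : ∀ i j, T i (k j) = ↑(k j * k i ^ (-a i j))

namespace FullLusztigSystem

variable {q : I → 𝕜} {a : I → I → ℤ} {E F : I → A} {k : I → Aˣ} {T : I → A →ₐ[𝕜] A}
  {i j l : I} (h : FullLusztigSystem q a E F k T)

theorem map_units_inv {B : Type*} [Ring B] [Algebra 𝕜 B] (φ : A →ₐ[𝕜] B) {x : Aˣ} {y : Bˣ}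
    (hxy : φ x = y) : φ ↑x⁻¹ = ↑y⁻¹ := by
  rw [← Units.ext (u := Units.map (φ : A →* B) x) hxy, ← map_inv]
  rfl

theorem op_word_k {φ : A →ₐ[𝕜] A} (hk : φ (k i) = k j) :
    AlgHom.op φ (opInv (k i)) = opInv (k j) :=
  congrArg MulOpposite.op (map_units_inv φ hk)

section Torus

/-- An element of the torus in the coset of `k l` modulo `k i` and `k j`. -/
def torus (k : I → Aˣ) (i j l : I) (x y : ℤ) : A := ↑(k l * k i ^ x * k j ^ y)

@[simp]
theorem torus_zero (k : I → Aˣ) (i j l : I) : torus k i j l 0 0 = (k l : A) := by simp [torus]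

theorem torus_one (k : I → Aˣ) (i j : I) : torus k i j i (-1) 1 = (k j : A) := by simp [torus]

include h

theorem map_k_unit (i j : I) : Units.map (T i : A →* A) (k j) = k j * k i ^ (-a i j) :=
  Units.ext (h.map_k i j)

theorem map_k_self (i : I) : Units.map (T i : A →* A) (k i) = (k i)⁻¹ := by
  rw [h.map_k_unit, h.diag, zpow_neg, zpow_two, mul_inv_rev, mul_inv_cancel_left]

theorem zpow_comm (i j : I) (x y : ℤ) : k i ^ x * k j ^ y = k j ^ y * k i ^ x :=
  (Commute.zpow_zpow (h.comm_k i j) x y).eq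

theorem map_k_zpow (i j : I) (x : ℤ) :
    Units.map (T i : A →* A) (k j ^ x) = k j ^ x * k i ^ (-a i j * x) := by
  rw [map_zpow, h.map_k_unit, Commute.mul_zpow (Commute.zpow_right (h.comm_k j i) _), zpow_mul]

theorem map_torus_left (x y : ℤ) :
    T i (torus k i j l x y) = torus k i j l (-a i l - x - a i j * y) y := by
  refine congrArg Units.val (?_ : Units.map (T i : A →* A) _ = _)
  rw [map_mul, map_mul, h.map_k_unit, map_zpow, h.map_k_self, inv_zpow', h.map_k_zpow,
    h.zpow_comm j i, ← mul_assoc, mul_assoc (k l), ← zpow_add, mul_assoc (k l), ← zpow_add]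
  ring_nf

theorem map_torus_right (x y : ℤ) :
    T j (torus k i j l x y) = torus k i j l x (-a j l - y - a j i * x) := by
  refine congrArg Units.val (?_ : Units.map (T j : A →* A) _ = _)
  rw [map_mul, map_mul, h.map_k_unit, h.map_k_zpow, map_zpow, h.map_k_self, inv_zpow',
    mul_assoc (k l), ← mul_assoc _ (k i ^ x), h.zpow_comm j i, mul_assoc, mul_assoc (k i ^ x),
    mul_assoc (k i ^ x), ← zpow_add, ← zpow_add, ← mul_assoc]
  ring_nf

end Torus

include h

section Zero

variable (haij : a i j = 0) (haji : a j i = 0)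
include haij haji

theorem braid_k_of_zero (l : I) : T j (T i (k l)) = T i (T j (k l)) := by
  simp only [← torus_zero k i j, h.map_torus_left, h.map_torus_right, haij, haji]
  ring_nf

omit haij in
theorem word_k_of_zero : T j (k i) = k i := by
  rw [← torus_zero k i j, h.map_torus_right, haji]
  simp [torus]

end Zero

section One

variable (haij : a i j = -1) (haji : a j i = -1)
include haij haji

theorem braid_k_of_one (l : I) : T i (T j (T i (k l))) = T j (T i (T j (k l))) := by
  simp only [← torus_zero k i j, h.map_torus_left, h.map_torus_right, haij, haji]
  ring_nf

theorem word_k_of_one : T i (T j (k i)) = k j := by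
  rw [← torus_zero k i j, h.map_torus_right, h.map_torus_left, haij, haji, h.diag]
  exact torus_one k i j

end One

section Two

variable (haij : a i j = -2) (haji : a j i = -1)
include haij haji

theorem braid_k_of_two (l : I) :
    T j (T i (T j (T i (k l)))) = T i (T j (T i (T j (k l)))) := by
  simp only [← torus_zero k i j, h.map_torus_left, h.map_torus_right, haij, haji]
  ring_nf

theorem word_k_of_two : T j (T i (T j (k i))) = k i := by
  simp only [← torus_zero k i j, h.map_torus_left, h.map_torus_right, haij, haji, h.diag]
  ring_nf

theorem word_k_of_two' : T i (T j (T i (k j))) = k j := by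
  simp only [← torus_zero k i j, h.map_torus_left, h.map_torus_right, haij, haji, h.diag]
  ring_nf

end Two

section Three

variable (haij : a i j = -3) (haji : a j i = -1)
include haij haji

theorem braid_k_of_three (l : I) : T j (T i (T j (T i (T j (T i (k l)))))) =
    T i (T j (T i (T j (T i (T j (k l)))))) := by
  simp only [← torus_zero k i j, h.map_torus_left, h.map_torus_right, haij, haji]
  ring_nf

theorem word_k_of_three : T j (T i (T j (T i (T j (k i))))) = k i := by
  simp only [← torus_zero k i j, h.map_torus_left, h.map_torus_right, haij, haji, h.diag]
  ring_nf

theorem word_k_of_three' : T i (T j (T i (T j (T i (k j))))) = k j := by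
  simp only [← torus_zero k i j, h.map_torus_left, h.map_torus_right, haij, haji, h.diag]
  ring_nf

end Three

theorem T_F_of_zero (hij : i ≠ j) (haij : a i j = 0) : T i (F j) = F j :=
  MulOpposite.op_injective (h.opSys.T_of_zero hij haij)

theorem braid_of_zero (hij : i ≠ j) (haij : a i j = 0) (haji : a j i = 0) (l : I) :
    T j (T i (E l)) = T i (T j (E l)) ∧ T j (T i (F l)) = T i (T j (F l)) :=
  ⟨h.sys.braid_E_of_zero hij haij haji (h.T_F_of_zero hij.symm haji) (h.T_F_of_zero hij haij)
      (h.word_k_of_zero haji) (h.word_k_of_zero haij) l,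
    MulOpposite.op_injective (h.opSys.braid_E_of_zero hij haij haji
      (congrArg MulOpposite.op (h.sys.T_of_zero hij.symm haji))
      (congrArg MulOpposite.op (h.sys.T_of_zero hij haij))
      (op_word_k (h.word_k_of_zero haji)) (op_word_k (h.word_k_of_zero haij)) l)⟩

theorem T_T_F_of_one (hij : i ≠ j) (haij : a i j = -1) (haji : a j i = -1) (hq : q i = q j) :
    T i (T j (F i)) = F j :=
  MulOpposite.op_injective (h.opSys.T_T_E_of_one hij haji haij (congrArg Inv.inv hq))

theorem braid_of_one (hij : i ≠ j) (haij : a i j = -1) (haji : a j i = -1) (hq : q i = q j)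
    (l : I) : T i (T j (T i (E l))) = T j (T i (T j (E l))) ∧
      T i (T j (T i (F l))) = T j (T i (T j (F l))) :=
  ⟨h.sys.braid_E_of_one hij haij haji hq (h.T_T_F_of_one hij haij haji hq)
      (h.T_T_F_of_one hij.symm haji haij hq.symm) (h.word_k_of_one haij haji)
      (h.word_k_of_one haji haij) l,
    MulOpposite.op_injective (h.opSys.braid_E_of_one hij haij haji (congrArg Inv.inv hq)
      (congrArg MulOpposite.op (h.sys.T_T_E_of_one hij haji haij hq))
      (congrArg MulOpposite.op (h.sys.T_T_E_of_one hij.symm haij haji hq.symm))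
      (op_word_k (φ := (T i).comp (T j)) (h.word_k_of_one haij haji))
      (op_word_k (φ := (T j).comp (T i)) (h.word_k_of_one haji haij)) l)⟩

section Two

variable (hij : i ≠ j) (haij : a i j = -(2 : ℕ)) (haji : a j i = -1) (hq : q i ^ 2 = q j)
include hij haij haji hq

theorem T_T_T_F_of_two : T j (T i (T j (F i))) = F i :=
  MulOpposite.op_injective (h.opSys.T_T_T_E_of_two hij haji haij (by simp [hq]))

theorem T_T_T_F_of_two' : T i (T j (T i (F j))) = F j :=
  MulOpposite.op_injective (h.opSys.T_T_T_E_of_two' hij haji haij (by simp [hq]))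

theorem braid_of_two (l : I) :
    T j (T i (T j (T i (E l)))) = T i (T j (T i (T j (E l)))) ∧
      T j (T i (T j (T i (F l)))) = T i (T j (T i (T j (F l)))) :=
  ⟨h.sys.braid_E_of_two hij haij haji hq (h.T_T_T_F_of_two hij haij haji hq)
      (h.T_T_T_F_of_two' hij haij haji hq) (h.word_k_of_two haij haji)
      (h.word_k_of_two' haij haji) l,
    MulOpposite.op_injective (h.opSys.braid_E_of_two hij haij haji (by simp [hq])
      (congrArg MulOpposite.op (h.sys.T_T_T_E_of_two hij haji haij hq))
      (congrArg MulOpposite.op (h.sys.T_T_T_E_of_two' hij haji haij hq))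
      (op_word_k (φ := (T j).comp ((T i).comp (T j)))
        (h.word_k_of_two haij haji))
      (op_word_k (φ := (T i).comp ((T j).comp (T i)))
        (h.word_k_of_two' haij haji)) l)⟩

end Two

section Three

variable (hij : i ≠ j) (haij : a i j = -(3 : ℕ)) (haji : a j i = -1) (hq : q i ^ 3 = q j)
include hij haij haji hq

theorem T_T_T_T_T_F_of_three : T j (T i (T j (T i (T j (F i))))) = F i :=
  MulOpposite.op_injective (h.opSys.T_T_T_T_T_E_of_three hij haji haij (by simp [hq]))

theorem T_T_T_T_T_F_of_three' : T i (T j (T i (T j (T i (F j))))) = F j :=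
  MulOpposite.op_injective (h.opSys.T_T_T_T_T_E_of_three' hij haji haij (by simp [hq]))

theorem braid_of_three (l : I) :
    T j (T i (T j (T i (T j (T i (E l)))))) = T i (T j (T i (T j (T i (T j (E l)))))) ∧
      T j (T i (T j (T i (T j (T i (F l)))))) = T i (T j (T i (T j (T i (T j (F l)))))) :=
  ⟨h.sys.braid_E_of_three hij haij haji hq (h.T_T_T_T_T_F_of_three hij haij haji hq)
      (h.T_T_T_T_T_F_of_three' hij haij haji hq) (h.word_k_of_three haij haji)
      (h.word_k_of_three' haij haji) l,
    MulOpposite.op_injective (h.opSys.braid_E_of_three hij haij haji (by simp [hq])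
      (congrArg MulOpposite.op (h.sys.T_T_T_T_T_E_of_three hij haji haij hq))
      (congrArg MulOpposite.op (h.sys.T_T_T_T_T_E_of_three' hij haji haij hq))
      (op_word_k (φ := (T j).comp ((T i).comp ((T j).comp ((T i).comp (T j)))))
        (h.word_k_of_three haij haji))
      (op_word_k (φ := (T i).comp ((T j).comp ((T i).comp ((T j).comp (T i)))))
        (h.word_k_of_three' haij haji)) l)⟩

end Three

end FullLusztigSystem

end Braid

section ClosedFormula

variable {𝕜 : Type*} [Field 𝕜] {A : Type*} [Ring A] [Algebra 𝕜 A] {q : 𝕜}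

/-- The quantum factorial. -/
def qnumFact (q : 𝕜) : ℕ → 𝕜
  | 0 => 1
  | n + 1 => qnumFact q n * qnum q (n + 1)

theorem qnumFact_inv (q : 𝕜) (n : ℕ) : qnumFact q⁻¹ n = qnumFact q n := by
  induction n with
  | zero => rfl
  | succ n ih => rw [qnumFact, qnumFact, ih, qnum_inv]

theorem Generic.qnumFact_ne_zero (hq : Generic q) (n : ℕ) : qnumFact q n ≠ 0 := by
  induction n with
  | zero => exact one_ne_zero
  | succ n ih => exact mul_ne_zero ih (hq.qnum_succ_ne_zero n)

theorem qnum_add (hq : Generic q) (x y : ℤ) :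
    qnum q (x + y) = q ^ (-y) * qnum q x + q ^ x * qnum q y := by
  have h0 := hq.1
  simp only [qnum, mul_div_assoc', ← add_div]
  congr 1
  rw [neg_add, zpow_add₀ h0, zpow_add₀ h0]
  ring

/-- The coefficients of the closed formula for `adj`. -/
def adjCoeff (q : 𝕜) (m n : ℕ) (x : ℕ × ℕ) : 𝕜 :=
  (-1) ^ x.2 * q ^ (x.2 * (n - 1 - m) : ℤ) * ((qnumFact q x.1)⁻¹ * (qnumFact q x.2)⁻¹)

theorem qnum_mul_inv_qnumFact (hq : Generic q) (n : ℕ) :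
    qnum q (n + 1) * (qnumFact q (n + 1))⁻¹ = (qnumFact q n)⁻¹ := by
  rw [qnumFact, mul_inv, mul_comm, mul_assoc, inv_mul_cancel₀ (hq.qnum_succ_ne_zero n), mul_one]

theorem adj_eq_sum (hq : Generic q) (e : A) (m : ℕ) (v : A) (n : ℕ) :
    adj q e m v n = ∑ x ∈ Finset.HasAntidiagonal.antidiagonal n,
      adjCoeff q m n x • (e ^ x.1 * v * e ^ x.2) := by
  have h0 := hq.1
  induction n with
  | zero => simp [adjCoeff, qnumFact]
  | succ n ih =>
    rw [adj, inv_smul_eq_iff₀ (hq.qnum_succ_ne_zero n), Finset.smul_sum]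
    have key : ∀ x ∈ Finset.HasAntidiagonal.antidiagonal (n + 1),
        qnum q (n + 1) • adjCoeff q m (n + 1) x • (e ^ x.1 * v * e ^ x.2) =
          (q ^ (-x.2 : ℤ) * qnum q x.1 * adjCoeff q m (n + 1) x) • (e ^ x.1 * v * e ^ x.2) +
          (q ^ (x.1 : ℤ) * qnum q x.2 * adjCoeff q m (n + 1) x) • (e ^ x.1 * v * e ^ x.2) := by
      intro x hx
      have hx : (n + 1 : ℤ) = x.1 + x.2 := by
        exact_mod_cast (Finset.HasAntidiagonal.mem_antidiagonal.mp hx).symm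
      rw [smul_smul, ← add_smul, hx, qnum_add hq, add_mul]
    rw [Finset.sum_congr rfl key, Finset.sum_add_distrib, Finset.Nat.sum_antidiagonal_succ,
      Finset.Nat.sum_antidiagonal_succ' (n := n), ih, Finset.mul_sum, Finset.sum_mul,
      Finset.smul_sum]
    simp only [Nat.cast_zero, qnum_zero, mul_zero, zero_mul, zero_smul, zero_add,
      sub_eq_add_neg, ← Finset.sum_neg_distrib]
    congr 1
    · refine Finset.sum_congr rfl fun x _ => ?_
      rw [mul_smul_comm, pow_succ', mul_assoc e, mul_assoc e]
      congr 1
      rw [adjCoeff, adjCoeff, ← qnum_mul_inv_qnumFact hq x.1]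
      push_cast
      rw [show (x.2 * (n + 1 - 1 - m) : ℤ) = x.2 * (n - 1 - m) + x.2 by ring, zpow_add₀ h0,
        zpow_neg]
      have := zpow_ne_zero (x.2 : ℤ) h0
      field_simp
    · refine Finset.sum_congr rfl fun x hx => ?_
      have hx : (n : ℤ) = x.1 + x.2 := by
        exact_mod_cast (Finset.HasAntidiagonal.mem_antidiagonal.mp hx).symm
      rw [smul_mul_assoc, smul_smul, ← neg_smul, pow_succ, mul_assoc _ (e ^ x.2)]
      congr 1
      rw [adjCoeff, adjCoeff, ← qnum_mul_inv_qnumFact hq x.2, pow_succ]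
      push_cast
      have : q ^ (x.1 : ℤ) * q ^ ((x.2 + 1) * (n + 1 - 1 - m) : ℤ) =
          q ^ (2 * n + -m : ℤ) * q ^ (x.2 * (n - 1 - m) : ℤ) := by
        rw [← zpow_add₀ h0, ← zpow_add₀ h0]
        congr 1
        linear_combination -hx
      linear_combination (-1) ^ x.2 * ((qnumFact q x.1)⁻¹ * (qnumFact q (x.2 + 1))⁻¹) *
        qnum q (x.2 + 1) * this

theorem adj_eq_sum_range (hq : Generic q) (e : A) (m : ℕ) (v : A) (n : ℕ) :
    adj q e m v n = ∑ s ∈ Finset.range (n + 1),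
      adjCoeff q m n (n - s, s) • (e ^ (n - s) * v * e ^ s) := by
  rw [adj_eq_sum hq, ← Finset.Nat.sum_antidiagonal_swap]
  exact Finset.Nat.sum_antidiagonal_eq_sum_range_succ_mk _ n

theorem adjTop_eq_sum (hq : Generic q) (e : A) (m : ℕ) (v : A) :
    adjTop q e m v = ∑ s ∈ Finset.range (m + 1), ((-1) ^ (s + m) * q⁻¹ ^ s) •
      ((qnumFact q (m - s))⁻¹ • e ^ (m - s) * v * (qnumFact q s)⁻¹ • e ^ s) := by
  rw [adjTop, adj_eq_sum_range hq, Finset.smul_sum]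
  refine Finset.sum_congr rfl fun s _ => ?_
  rw [smul_mul_assoc, smul_mul_assoc, mul_smul_comm, smul_smul, smul_smul, smul_smul, adjCoeff]
  congr 1
  rw [show (s * (m - 1 - m) : ℤ) = -s by ring, zpow_neg, zpow_natCast, inv_pow, pow_add]
  ring

theorem qnumFact_smul_adj_succ (hq : Generic q) (e : A) (m : ℕ) (v : A) :
    qnumFact q (m + 1) • adj q e m v (m + 1) = ∑ s ∈ Finset.range (m + 1 + 1),
      ((-1) ^ s * (qnumFact q (m + 1) / (qnumFact q s * qnumFact q (m + 1 - s)))) •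
        (e ^ (m + 1 - s) * v * e ^ s) := by
  rw [adj_eq_sum_range hq, Finset.smul_sum]
  refine Finset.sum_congr rfl fun s _ => ?_
  rw [smul_smul, adjCoeff]
  congr 1
  push_cast
  rw [add_sub_cancel_right, sub_self, mul_zero, zpow_zero, div_eq_mul_inv, mul_inv]
  ring

end ClosedFormula

section Opposite

variable {𝕜 : Type*} [Field 𝕜] {A : Type*} [Ring A] [Algebra 𝕜 A] {q : 𝕜} {e f x : A} {k : Aˣ}
  {w : ℤ} {T : A →ₐ[𝕜] A}

theorem HasWt.op (hq : q ≠ 0) (hx : HasWt q k (-w) x) :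
    HasWt q⁻¹ (opInv k) w (MulOpposite.op x) := by
  have h1 := hx.units_inv hq
  rw [neg_neg] at h1
  refine MulOpposite.unop_injective (?_ : x * ↑k⁻¹ = q⁻¹ ^ w • (↑k⁻¹ * x))
  rw [h1, smul_smul, ← mul_zpow, inv_mul_cancel₀ hq, one_zpow, one_smul]

theorem IsQuantumSl2.op (h : IsQuantumSl2 q e f k) :
    IsQuantumSl2 q⁻¹ (MulOpposite.op f) (MulOpposite.op e) (opInv k) where
  generic := h.generic.inv
  wt_e := h.wt_f.op h.generic.1
  wt_f := HasWt.op (w := -2) h.generic.1 h.wt_e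
  lie := MulOpposite.unop_injective <| by
    refine (?_ : e * f - f * e = (q⁻¹ - q⁻¹⁻¹)⁻¹ • (↑k⁻¹ - (k : A)))
    rw [h.lie, inv_inv, ← neg_sub q, ← neg_sub (k : A), inv_neg, neg_smul_neg]

theorem IsReflection.op (h : IsReflection q e f k T) :
    IsReflection q⁻¹ (MulOpposite.op f) (MulOpposite.op e) (opInv k) (AlgHom.op T) where
  sl2 := h.sl2.op
  map_e := congrArg MulOpposite.op h.map_f
  map_f := congrArg MulOpposite.op h.map_e
  map_k := congrArg MulOpposite.op h.map_k_inv

end Opposite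

section Affine

variable {a : Fin n → Fin n → ℤ} {d r : Fin n → ℕ} {i j : Fin n}

theorem qfact_eq (d : Fin n → ℕ) (i : Fin n) (m : ℕ) : qfact d i m = qnumFact (qi d i) m := by
  induction m with
  | zero => rfl
  | succ m ih => rw [qfact, qnumFact, ih]; rfl

theorem generic_qvar : Generic qvar := by
  refine ⟨RatFunc.X_ne_zero, fun m hm => ?_⟩
  rw [qvar, ← RatFunc.algebraMap_X, ← map_pow, ← map_one (algebraMap (Polynomial ℚ) (RatFunc ℚ)),
    (RatFunc.algebraMap_injective ℚ).eq_iff] at hm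
  simpa using congrArg Polynomial.natDegree hm

theorem generic_qi (hd : 0 < d i) : Generic (qi d i) := by
  have := generic_qvar.zpow (z := d i) (by omega)
  rwa [zpow_natCast] at this

variable (a d r) in
/-- The unit of `U_q` given by the generator `K i`. -/
def unitK (i : Fin n) : (Uq a d r)ˣ where
  val := gen a d r (Gen.K i)
  inv := gen a d r (Gen.Kinv i)
  val_inv := by simpa [gen] using RingQuot.mkAlgHom_rel Kq (QRel.KKinv (a := a) (d := d) (r := r) i)
  inv_val := by simpa [gen] using RingQuot.mkAlgHom_rel Kq (QRel.KinvK (a := a) (d := d) (r := r) i)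

theorem Kzpow_eq (i : Fin n) (m : ℤ) : Kzpow a d r i m = ↑(unitK a d r i ^ m) := by
  rw [Kzpow]
  split_ifs with hm
  · obtain ⟨m, rfl⟩ := Int.eq_ofNat_of_zero_le hm
    simp [unitK]
  · obtain ⟨m, rfl⟩ : ∃ l : ℕ, m = -l := ⟨(-m).toNat, by omega⟩
    simp [unitK]

theorem hasWt_E (i j : Fin n) : HasWt (qi d i) (unitK a d r i) (a i j) (gen a d r (Gen.E j)) := by
  have := RingQuot.mkAlgHom_rel Kq (QRel.KE (a := a) (d := d) (r := r) i j)
  rw [map_mul, map_smul, map_mul] at this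
  exact this

theorem hasWt_F (i j : Fin n) :
    HasWt (qi d i) (unitK a d r i) (-a i j) (gen a d r (Gen.F j)) := by
  have := RingQuot.mkAlgHom_rel Kq (QRel.KF (a := a) (d := d) (r := r) i j)
  rw [map_mul, map_smul, map_mul] at this
  exact this

theorem lie_E_F (i j : Fin n) : gen a d r (Gen.E i) * gen a d r (Gen.F j) -
    gen a d r (Gen.F j) * gen a d r (Gen.E i) = if i = j then (qi d i - (qi d i)⁻¹)⁻¹ •
      (gen a d r (Gen.K i) - gen a d r (Gen.Kinv i)) else 0 := by
  have := RingQuot.mkAlgHom_rel Kq (QRel.EF (a := a) (d := d) (r := r) i j)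
  split_ifs at this ⊢ <;> simpa [gen] using this

theorem unitK_comm (i j : Fin n) :
    unitK a d r i * unitK a d r j = unitK a d r j * unitK a d r i := by
  apply Units.ext
  simpa [gen, unitK] using RingQuot.mkAlgHom_rel Kq (QRel.KK (a := a) (d := d) (r := r) i j)

theorem toNat_one_sub (h : a i j ≤ 0) : (1 - a i j).toNat = (-a i j).toNat + 1 := by omega

theorem adj_E_eq_zero (hd : 0 < d i) (ha : a i j ≤ 0) (hij : i ≠ j) :
    adj (qi d i) (gen a d r (Gen.E i)) (-a i j).toNat (gen a d r (Gen.E j))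
      ((-a i j).toNat + 1) = 0 := by
  have hg := generic_qi hd
  have h1 := RingQuot.mkAlgHom_rel Kq (QRel.serreEE (a := a) (d := d) (r := r) i j hij)
  rw [serreE, map_sum, map_zero, toNat_one_sub ha] at h1
  refine (smul_eq_zero_iff_right (hg.qnumFact_ne_zero ((-a i j).toNat + 1))).mp ?_
  rw [qnumFact_smul_adj_succ hg, ← h1]
  simp only [map_smul, map_mul, map_pow, gen, qbinom, qfact_eq]

theorem adj_F_eq_zero (hd : 0 < d i) (ha : a i j ≤ 0) (hij : i ≠ j) :
    adj (qi d i)⁻¹ (MulOpposite.op (gen a d r (Gen.F i))) (-a i j).toNat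
      (MulOpposite.op (gen a d r (Gen.F j))) ((-a i j).toNat + 1) = 0 := by
  have hg := generic_qi hd
  have h1 := RingQuot.mkAlgHom_rel Kq (QRel.serreFF (a := a) (d := d) (r := r) i j hij)
  rw [serreF, map_sum, map_zero, toNat_one_sub ha, ← Finset.sum_flip] at h1
  refine (smul_eq_zero_iff_right (hg.inv.qnumFact_ne_zero ((-a i j).toNat + 1))).mp ?_
  rw [qnumFact_smul_adj_succ hg.inv]
  apply MulOpposite.unop_injective
  have h2 := congrArg (fun x => (-1 : Kq) ^ ((-a i j).toNat + 1) • x) h1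
  simp only [smul_zero, Finset.smul_sum] at h2
  rw [MulOpposite.unop_zero, ← h2, Finset.unop_sum]
  refine Finset.sum_congr rfl fun s hs => ?_
  have hs : s ≤ (-a i j).toNat + 1 := by
    have := Finset.mem_range.mp hs
    omega
  have h3 : (-1 : Kq) ^ ((-a i j).toNat + 1) * (-1) ^ ((-a i j).toNat + 1 - s) = (-1) ^ s := by
    obtain ⟨t, ht⟩ := Nat.exists_eq_add_of_le hs
    rw [ht, Nat.add_sub_cancel_left, pow_add, mul_assoc, ← mul_pow]
    simp
  simp only [map_smul, map_mul, map_pow, gen, qbinom, qfact_eq, qnumFact_inv, smul_smul,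
    MulOpposite.unop_smul, MulOpposite.unop_mul, MulOpposite.unop_pow, MulOpposite.unop_op,
    Nat.sub_sub_self hs, mul_assoc]
  rw [← h3, mul_comm (qnumFact _ s), mul_assoc]

theorem TE_eq (hd : 0 < d i) : TE a d r i j =
    adjTop (qi d i) (gen a d r (Gen.E i)) (-a i j).toNat (gen a d r (Gen.E j)) := by
  rw [adjTop_eq_sum (generic_qi hd), TE]
  simp only [Ediv, qfact_eq]

theorem TF_eq (hd : 0 < d i) : MulOpposite.op (TF a d r i j) =
    adjTop (qi d i)⁻¹ (MulOpposite.op (gen a d r (Gen.F i))) (-a i j).toNat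
      (MulOpposite.op (gen a d r (Gen.F j))) := by
  rw [adjTop_eq_sum (generic_qi hd).inv, TF]
  simp only [Fdiv, qfact_eq, Finset.op_sum, MulOpposite.op_smul, MulOpposite.op_mul,
    MulOpposite.op_pow, qnumFact_inv, inv_inv, mul_assoc]

theorem isReflection (hC : CartanData n a d r) {T : Uq a d r ≃ₐ[Kq] Uq a d r}
    (hT : TCond a d r i T) : IsReflection (qi d i) (gen a d r (Gen.E i)) (gen a d r (Gen.F i))
      (unitK a d r i) T where
  sl2 :=
    { generic := generic_qi (hC.d_pos i)
      wt_e := hC.diag i ▸ hasWt_E i i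
      wt_f := hC.diag i ▸ hasWt_F i i
      lie := (lie_E_F i i).trans (if_pos rfl) }
  map_e := hT.1
  map_f := hT.2.1
  map_k := by
    have h1 := hT.2.2.1 i
    rw [Kzpow_eq, hC.diag] at h1
    refine h1.trans ?_
    rw [zpow_neg, zpow_two, mul_inv_rev]
    exact congrArg Units.val (mul_inv_cancel_left (unitK a d r i) (unitK a d r i)⁻¹)

theorem F_mul_E (hij : i ≠ j) : gen a d r (Gen.F i) * gen a d r (Gen.E j) =
    gen a d r (Gen.E j) * gen a d r (Gen.F i) := by
  have := lie_E_F (a := a) (d := d) (r := r) j i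
  rw [if_neg hij.symm, sub_eq_zero] at this
  exact this.symm

theorem fullLusztigSystem (hC : CartanData n a d r) {T : Fin n → (Uq a d r ≃ₐ[Kq] Uq a d r)}
    (hT : ∀ i, TCond a d r i (T i)) :
    FullLusztigSystem (qi d) a (fun i => gen a d r (Gen.E i)) (fun i => gen a d r (Gen.F i))
      (unitK a d r) (fun i => (T i : Uq a d r →ₐ[Kq] Uq a d r)) where
  sys :=
    { reflection := fun i => isReflection hC (hT i)
      wt := hasWt_E
      nonpos := hC.offdiag
      comm := fun _ _ => F_mul_E
      serre := fun i j hij => adj_E_eq_zero (hC.d_pos i) (hC.offdiag i j hij) hij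
      map_E := fun i j hij => ((hT i).2.2.2.2.1 j hij.symm).trans (TE_eq (hC.d_pos i)) }
  opSys :=
    { reflection := fun i => (isReflection hC (hT i)).op
      wt := fun i j => (hasWt_F i j).op (generic_qi (hC.d_pos i)).1
      nonpos := hC.offdiag
      comm := fun _ _ hij => congrArg MulOpposite.op (F_mul_E hij.symm)
      serre := fun i j hij => adj_F_eq_zero (hC.d_pos i) (hC.offdiag i j hij) hij
      map_E := fun i j hij => (congrArg MulOpposite.op ((hT i).2.2.2.2.2 j hij.symm)).trans
        (TF_eq (hC.d_pos i)) }
  diag := hC.diag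
  comm_k := unitK_comm
  map_k := fun i j => ((hT i).2.2.1 j).trans <| by
    rw [Kzpow_eq, Units.val_mul]
    rfl

/-- Two endomorphisms of `U_q` agree if they do so on `E i`, `F i`, `K i` and fix `γ^{1/2}`. -/
theorem eq_of_eq_on_gen {φ ψ : Uq a d r →ₐ[Kq] Uq a d r}
    (hEF : ∀ l, φ (gen a d r (Gen.E l)) = ψ (gen a d r (Gen.E l)) ∧
      φ (gen a d r (Gen.F l)) = ψ (gen a d r (Gen.F l)))
    (hK : ∀ l, φ (unitK a d r l) = ψ (unitK a d r l))
    (hφ : φ (gen a d r Gen.g) = gen a d r Gen.g) (hψ : ψ (gen a d r Gen.g) = gen a d r Gen.g)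
    (x : Uq a d r) : φ x = ψ x := by
  let γ : (Uq a d r)ˣ :=
    { val := gen a d r Gen.g
      inv := gen a d r Gen.ginv
      val_inv := by
        simpa [gen] using RingQuot.mkAlgHom_rel Kq (QRel.gginv (a := a) (d := d) (r := r))
      inv_val := by
        simpa [gen] using RingQuot.mkAlgHom_rel Kq (QRel.ginvg (a := a) (d := d) (r := r)) }
  have inv_eq {u : (Uq a d r)ˣ} (hu : φ u = ψ u) : φ ↑u⁻¹ = ψ ↑u⁻¹ :=
    FullLusztigSystem.map_units_inv φ (y := Units.map (ψ : Uq a d r →* Uq a d r) u) hu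
  refine DFunLike.congr_fun (?_ : φ = ψ) x
  refine RingQuot.ringQuot_ext' _ _ _ (FreeAlgebra.hom_ext (funext fun y => ?_))
  cases y with
  | E l => exact (hEF l).1
  | F l => exact (hEF l).2
  | K l => exact hK l
  | Kinv l => exact inv_eq (hK l)
  | g => exact hφ.trans hψ.symm
  | ginv => exact inv_eq (u := γ) (hφ.trans hψ.symm)

theorem qi_eq (hC : CartanData n a d r) {m : ℕ} (haij : a i j = -m) (haji : a j i = -1) :
    qi d i ^ m = qi d j := by
  have h1 := hC.symmetrizable i j
  rw [haij, haji, mul_neg, mul_neg, mul_one, neg_inj] at h1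
  rw [qi, qi, ← pow_mul, show d i * m = d j by exact_mod_cast h1]

section BraidRelations

variable (hC : CartanData n a d r) {T : Fin n → (Uq a d r ≃ₐ[Kq] Uq a d r)}
  (hT : ∀ i, TCond a d r i (T i)) (hij : i ≠ j)
include hC hT hij

theorem braid_apply_of_zero (haij : a i j = 0) (haji : a j i = 0) (x : Uq a d r) :
    T j (T i x) = T i (T j x) := by
  have h := fullLusztigSystem hC hT
  have hg : ∀ i, T i (gen a d r Gen.g) = gen a d r Gen.g := fun i => (hT i).2.2.2.1
  let τ : Fin n → Uq a d r →ₐ[Kq] Uq a d r := fun i => T i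
  exact eq_of_eq_on_gen (φ := (τ j).comp (τ i))
    (ψ := (τ i).comp (τ j))
    (h.braid_of_zero hij haij haji) (h.braid_k_of_zero haij haji)
    (by simp [τ, hg]) (by simp [τ, hg]) x

theorem braid_apply_of_one (haij : a i j = -1) (haji : a j i = -1) (x : Uq a d r) :
    T i (T j (T i x)) = T j (T i (T j x)) := by
  have h := fullLusztigSystem hC hT
  have hg : ∀ i, T i (gen a d r Gen.g) = gen a d r Gen.g := fun i => (hT i).2.2.2.1
  let τ : Fin n → Uq a d r →ₐ[Kq] Uq a d r := fun i => T i
  exact eq_of_eq_on_gen (φ := (τ i).comp ((τ j).comp (τ i)))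
    (ψ := (τ j).comp ((τ i).comp (τ j)))
    (h.braid_of_one hij haij haji (by simpa using qi_eq hC (m := 1) (by simpa using haij) haji))
    (h.braid_k_of_one haij haji)
    (by simp [τ, hg]) (by simp [τ, hg]) x

theorem braid_apply_of_two (haij : a i j = -2) (haji : a j i = -1) (x : Uq a d r) :
    T j (T i (T j (T i x))) = T i (T j (T i (T j x))) := by
  have h := fullLusztigSystem hC hT
  have hg : ∀ i, T i (gen a d r Gen.g) = gen a d r Gen.g := fun i => (hT i).2.2.2.1
  let τ : Fin n → Uq a d r →ₐ[Kq] Uq a d r := fun i => T i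
  exact eq_of_eq_on_gen (φ := (τ j).comp ((τ i).comp ((τ j).comp (τ i))))
    (ψ := (τ i).comp ((τ j).comp ((τ i).comp (τ j))))
    (h.braid_of_two hij haij haji (qi_eq hC haij haji)) (h.braid_k_of_two haij haji)
    (by simp [τ, hg]) (by simp [τ, hg]) x

theorem braid_apply_of_three (haij : a i j = -3) (haji : a j i = -1) (x : Uq a d r) :
    T j (T i (T j (T i (T j (T i x))))) = T i (T j (T i (T j (T i (T j x))))) := by
  have h := fullLusztigSystem hC hT
  have hg : ∀ i, T i (gen a d r Gen.g) = gen a d r Gen.g := fun i => (hT i).2.2.2.1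
  let τ : Fin n → Uq a d r →ₐ[Kq] Uq a d r := fun i => T i
  exact eq_of_eq_on_gen (φ := (τ j).comp ((τ i).comp ((τ j).comp ((τ i).comp ((τ j).comp (τ i))))))
    (ψ := (τ i).comp ((τ j).comp ((τ i).comp ((τ j).comp ((τ i).comp (τ j))))))
    (h.braid_of_three hij haij haji (qi_eq hC haij haji)) (h.braid_k_of_three haij haji)
    (by simp [τ, hg]) (by simp [τ, hg]) x

end BraidRelations

theorem neg_le_of_mul_eq {x y p : ℤ} (hp : 0 < p) (h : x * y = p) : -p ≤ x := by
  have := Int.le_of_dvd hp (neg_dvd.mpr (Dvd.intro y h))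
  omega

theorem eq_neg_one_of_mul_eq_one {x y : ℤ} (hx : x ≤ 0) (h : x * y = 1) : x = -1 ∧ y = -1 := by
  have := neg_le_of_mul_eq one_pos h
  interval_cases x <;> omega

theorem eq_of_mul_eq_two {x y : ℤ} (hx : x ≤ 0) (h : x * y = 2) :
    x = -2 ∧ y = -1 ∨ x = -1 ∧ y = -2 := by
  have := neg_le_of_mul_eq two_pos h
  interval_cases x <;> omega

theorem eq_of_mul_eq_three {x y : ℤ} (hx : x ≤ 0) (h : x * y = 3) :
    x = -3 ∧ y = -1 ∨ x = -1 ∧ y = -3 := by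
  have := neg_le_of_mul_eq three_pos h
  interval_cases x <;> omega

end Affine

end QuantumBraid

/-- The Lusztig braid operators satisfy the braid relations of the Weyl group. -/
theorem braid_relations {n : ℕ} (a : Fin n → Fin n → ℤ) (d r : Fin n → ℕ)
    (hC : CartanData n a d r)
    (T : Fin n → (Uq a d r ≃ₐ[Kq] Uq a d r)) (hT : ∀ i, TCond a d r i (T i))
    (i j : Fin n) (hij : i ≠ j) :
    (a i j * a j i = 0 → ∀ x, T i (T j x) = T j (T i x)) ∧
    (a i j * a j i = 1 → ∀ x, T i (T j (T i x)) = T j (T i (T j x))) ∧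
    (a i j * a j i = 2 → ∀ x, T i (T j (T i (T j x))) = T j (T i (T j (T i x)))) ∧
    (a i j * a j i = 3 → ∀ x,
      T i (T j (T i (T j (T i (T j x))))) = T j (T i (T j (T i (T j (T i x)))))) := by
  refine ⟨fun h x => ?_, fun h x => ?_, fun h x => ?_, fun h x => ?_⟩
  · have haij : a i j = 0 := (mul_eq_zero.mp h).elim id (hC.zero_iff i j).mpr
    exact (QuantumBraid.braid_apply_of_zero hC hT hij haij ((hC.zero_iff i j).mp haij) x).symm
  · obtain ⟨haij, haji⟩ := QuantumBraid.eq_neg_one_of_mul_eq_one (hC.offdiag i j hij) h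
    exact QuantumBraid.braid_apply_of_one hC hT hij haij haji x
  · obtain ⟨haij, haji⟩ | ⟨haij, haji⟩ := QuantumBraid.eq_of_mul_eq_two (hC.offdiag i j hij) h
    · exact (QuantumBraid.braid_apply_of_two hC hT hij haij haji x).symm
    · exact QuantumBraid.braid_apply_of_two hC hT hij.symm haji haij x
  · obtain ⟨haij, haji⟩ | ⟨haij, haji⟩ := QuantumBraid.eq_of_mul_eq_three (hC.offdiag i j hij) h
    · exact (QuantumBraid.braid_apply_of_three hC hT hij haij haji x).symm
    · exact QuantumBraid.braid_apply_of_three hC hT hij.symm haji haij x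

end
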